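/- arXiv:2105.09602 — 9 statements merged into one kernel-verified Lean document; each statement's English description precedes it below -/
import Mathlib

section
/- If an instance of the super-stable matching problem admits at least one super-stable matching, then there exists a unique super-stable matching M₀ (the man-optimal super-stable matching) that dominates every super-stable matching of the instance: for every super-stable matching N and every man m matched in N, m is matched in M₀ and M₀(m) ⪰_m N(m). -/
open scoped Classical

/-- An instance of the super-stable matching problem: a finite bipartite graph with
men `A`, women `B`, edge set `E`, and for each vertex a total preorder (preference
list with ties) on its neighbors. `prefA a b b'` means `b ⪰_a b'`. -/
structure SMInstance (A B : Type*) where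
  E : Finset (A × B)
  prefA : A → B → B → Prop
  prefB : B → A → A → Prop
  prefA_refl : ∀ a b, (a, b) ∈ E → prefA a b b
  prefA_trans : ∀ a b₁ b₂ b₃, prefA a b₁ b₂ → prefA a b₂ b₃ → prefA a b₁ b₃
  prefA_total : ∀ a b₁ b₂, (a, b₁) ∈ E → (a, b₂) ∈ E → prefA a b₁ b₂ ∨ prefA a b₂ b₁
  prefB_refl : ∀ b a, (a, b) ∈ E → prefB b a a
  prefB_trans : ∀ b a₁ a₂ a₃, prefB b a₁ a₂ → prefB b a₂ a₃ → prefB b a₁ a₃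
  prefB_total : ∀ b a₁ a₂, (a₁, b) ∈ E → (a₂, b) ∈ E → prefB b a₁ a₂ ∨ prefB b a₂ a₁

namespace SMInstance

variable {A B : Type*}

/-- A matching: a set of pairwise disjoint edges of the graph. -/
def IsMatching (I : SMInstance A B) (M : Finset (A × B)) : Prop :=
  M ⊆ I.E ∧
  (∀ p ∈ M, ∀ q ∈ M, p.1 = q.1 → p = q) ∧
  (∀ p ∈ M, ∀ q ∈ M, p.2 = q.2 → p = q)

/-- `(a,b)` is a blocking edge for `M`: it is an edge outside `M`, `a` is unmatched
or weakly prefers `b` to its partner, and `b` is unmatched or weakly prefers `a` to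
its partner. -/
def Blocks (I : SMInstance A B) (M : Finset (A × B)) (a : A) (b : B) : Prop :=
  (a, b) ∈ I.E ∧ (a, b) ∉ M ∧
  (∀ b', (a, b') ∈ M → I.prefA a b b') ∧
  (∀ a', (a', b) ∈ M → I.prefB b a a')

/-- A super-stable matching: a matching with no blocking edge. -/
def SuperStable (I : SMInstance A B) (M : Finset (A × B)) : Prop :=
  I.IsMatching M ∧ ∀ a b, ¬ I.Blocks M a b

/-- `M` dominates `N`: every man matched in `N` is matched in `M` to a partner he
weakly prefers. -/
def Dominates (I : SMInstance A B) (M N : Finset (A × B)) : Prop :=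
  ∀ a b, (a, b) ∈ N → ∃ b', (a, b') ∈ M ∧ I.prefA a b' b

/-- Strict preference `b ≻_a b'`. -/
def SPrefA (I : SMInstance A B) (a : A) (b b' : B) : Prop :=
  I.prefA a b b' ∧ ¬ I.prefA a b' b

/-- Strict preference `a ≻_b a'`. -/
def SPrefB (I : SMInstance A B) (b : B) (a a' : A) : Prop :=
  I.prefB b a a' ∧ ¬ I.prefB b a' a

end SMInstance

namespace SMInstance

variable {A B : Type*} {I : SMInstance A B} {M N : Finset (A × B)}

theorem IsMatching.eq_right (hM : I.IsMatching M) {a : A} {b b' : B}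
    (h : (a, b) ∈ M) (h' : (a, b') ∈ M) : b = b' :=
  congrArg Prod.snd (hM.2.1 _ h _ h' rfl)

theorem IsMatching.eq_left (hM : I.IsMatching M) {a a' : A} {b : B}
    (h : (a, b) ∈ M) (h' : (a', b) ∈ M) : a = a' :=
  congrArg Prod.fst (hM.2.2 _ h _ h' rfl)

theorem SuperStable.exists_of_notMem (hM : I.SuperStable M) {a : A} {b : B}
    (hE : (a, b) ∈ I.E) (h : (a, b) ∉ M) :
    (∃ b', (a, b') ∈ M ∧ ¬ I.prefA a b b') ∨ ∃ a', (a', b) ∈ M ∧ ¬ I.prefB b a a' := by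
  by_contra! hc
  exact hM.2 a b ⟨hE, h, hc.1, hc.2⟩

theorem Dominates.trans {L : Finset (A × B)} (h : I.Dominates L M) (h' : I.Dominates M N) :
    I.Dominates L N := by
  intro a b hab
  obtain ⟨b₁, h₁, hp₁⟩ := h' a b hab
  obtain ⟨b₂, h₂, hp₂⟩ := h a b₁ h₁
  exact ⟨b₂, h₂, I.prefA_trans _ _ _ _ hp₂ hp₁⟩

/-- The edges of `M` whose man is unmatched in `N` or weakly prefers them to his edge of `N`. -/
noncomputable def best (I : SMInstance A B) (M N : Finset (A × B)) : Finset (A × B) :=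
  M.filter fun p => ∀ b', (p.1, b') ∈ N → I.prefA p.1 p.2 b'

theorem mem_best {a : A} {b : B} :
    (a, b) ∈ I.best M N ↔ (a, b) ∈ M ∧ ∀ b', (a, b') ∈ N → I.prefA a b b' := by
  simp [best]

/-- If a man weakly prefers his edge of `M` to his situation in `N`, then its woman has another
partner in `N`, whom she strictly prefers and who strictly prefers his own partner in `M`. -/
theorem SuperStable.exists_of_mem_best (hM : I.SuperStable M) (hN : I.SuperStable N)
    {a : A} {b : B} (h : (a, b) ∈ I.best M N) (hb : (a, b) ∉ N) :
    ∃ a' b', (a', b) ∈ N ∧ (a', b') ∈ M ∧ ¬ I.prefA a' b b' ∧ ¬ I.prefB b a a' := by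
  obtain ⟨hab, hpref⟩ := mem_best.1 h
  obtain ⟨b', hb', hn⟩ | ⟨a', ha', hn⟩ := hN.exists_of_notMem (hM.1.1 hab) hb
  · exact absurd (hpref b' hb') hn
  · have hnot : (a', b) ∉ M := fun hm => hb (hM.1.eq_left hm hab ▸ ha')
    obtain ⟨b', hb', hn'⟩ | ⟨a'', ha'', hn'⟩ := hM.exists_of_notMem (hN.1.1 ha') hnot
    · exact ⟨a', b', ha', hb', hn', hn⟩
    · obtain rfl := hM.1.eq_left ha'' hab
      exact absurd ((I.prefB_total b a' a'' (hN.1.1 ha') (hM.1.1 hab)).resolve_left hn') hn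

/-- A man who weakly prefers his edge of `M` to his situation in `N`, where the edge is not in
`N`, strictly prefers it to an edge of `N`, whose woman is also matched by `I.best M N`. -/
theorem SuperStable.exists_mem_best_of_mem_best (hM : I.SuperStable M) (hN : I.SuperStable N)
    {a : A} {b : B} (h : (a, b) ∈ I.best M N) (hb : (a, b) ∉ N) :
    ∃ a₀ b₀, (a₀, b₀) ∈ I.best M N ∧ (a, b₀) ∈ N ∧ ¬ I.prefA a b₀ b := by
  have key : ∀ p ∈ I.best M N \ N, ∃ q ∈ I.best M N \ N,
      (q.1, p.2) ∈ N ∧ ¬ I.prefA q.1 p.2 q.2 := by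
    rintro ⟨a, b⟩ hp
    rw [Finset.mem_sdiff] at hp
    obtain ⟨a', b', h₁, h₂, h₃, -⟩ := hM.exists_of_mem_best hN hp.1 hp.2
    refine ⟨(a', b'), Finset.mem_sdiff.2 ⟨mem_best.2 ⟨h₂, fun c hc => ?_⟩, fun hc => ?_⟩, h₁, h₃⟩
    · obtain rfl := hN.1.eq_right h₁ hc
      exact (I.prefA_total _ _ _ (hN.1.1 h₁) (hM.1.1 h₂)).resolve_left h₃
    · obtain rfl := hN.1.eq_right h₁ hc
      exact h₃ (I.prefA_refl _ _ (hN.1.1 h₁))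
  choose! f hf hfN hfp using key
  have hinj : Set.InjOn f (I.best M N \ N : Finset (A × B)) := by
    rintro ⟨a, b⟩ hp ⟨a', b'⟩ hq heq
    have h₁ := hfN _ hp
    have h₂ := hfN _ hq
    rw [← heq] at h₂
    obtain rfl : b = b' := hN.1.eq_right h₁ h₂
    exact hM.1.2.2 _ (mem_best.1 (Finset.mem_sdiff.1 hp).1).1 _
      (mem_best.1 (Finset.mem_sdiff.1 hq).1).1 rfl
  obtain ⟨⟨a₀, b₀⟩, hp, heq⟩ :=
    Finset.surjOn_of_injOn_of_card_le f hf hinj le_rfl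
      (Finset.mem_coe.2 (Finset.mem_sdiff.2 ⟨h, hb⟩))
  have h₁ := hfN _ hp
  have h₂ := hfp _ hp
  rw [heq] at h₁ h₂
  exact ⟨a₀, b₀, (Finset.mem_sdiff.1 hp).1, h₁, h₂⟩

/-- The matching in which every man receives the better of his partners in `M` and `N`. -/
noncomputable def join (I : SMInstance A B) (M N : Finset (A × B)) : Finset (A × B) :=
  I.best M N ∪ I.best N M

theorem mem_join {p : A × B} : p ∈ I.join M N ↔ p ∈ I.best M N ∨ p ∈ I.best N M :=
  Finset.mem_union

theorem join_comm : I.join M N = I.join N M :=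
  Finset.union_comm _ _

theorem SuperStable.dominates_join_left (hM : I.SuperStable M) (hN : I.SuperStable N) :
    I.Dominates (I.join M N) M := by
  intro a b hab
  by_cases h : ∀ b', (a, b') ∈ N → I.prefA a b b'
  · exact ⟨b, mem_join.2 (.inl (mem_best.2 ⟨hab, h⟩)), I.prefA_refl _ _ (hM.1.1 hab)⟩
  · push Not at h
    obtain ⟨b', hb', hn⟩ := h
    have hp := (I.prefA_total _ _ _ (hM.1.1 hab) (hN.1.1 hb')).resolve_left hn
    refine ⟨b', mem_join.2 (.inr (mem_best.2 ⟨hb', fun c hc => ?_⟩)), hp⟩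
    exact hM.1.eq_right hab hc ▸ hp

theorem SuperStable.eq_right_of_mem_best (hM : I.SuperStable M) (hN : I.SuperStable N)
    {a : A} {b b' : B} (h : (a, b) ∈ I.best M N) (h' : (a, b') ∈ I.best N M) : b = b' := by
  obtain ⟨hM₁, -⟩ := mem_best.1 h
  obtain ⟨hN₁, hp⟩ := mem_best.1 h'
  by_cases hb : (a, b) ∈ N
  · exact hN.1.eq_right hb hN₁
  · obtain ⟨-, b₀, -, hb₀, hn⟩ := hM.exists_mem_best_of_mem_best hN h hb
    obtain rfl := hN.1.eq_right hb₀ hN₁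
    exact absurd (hp b hM₁) hn

theorem SuperStable.eq_left_of_mem_best (hM : I.SuperStable M) (hN : I.SuperStable N)
    {a a' : A} {b : B} (h : (a, b) ∈ I.best M N) (h' : (a', b) ∈ I.best N M) : a = a' := by
  obtain ⟨hN₁, hp⟩ := mem_best.1 h'
  by_cases hb : (a, b) ∈ N
  · exact hN.1.eq_left hb hN₁
  · obtain ⟨a'', b'', h₁, h₂, hn, -⟩ := hM.exists_of_mem_best hN h hb
    obtain rfl := hN.1.eq_left h₁ hN₁
    exact absurd (hp _ h₂) hn

theorem SuperStable.isMatching_join (hM : I.SuperStable M) (hN : I.SuperStable N) :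
    I.IsMatching (I.join M N) := by
  refine ⟨?_, ?_, ?_⟩
  · rintro ⟨a, b⟩ h
    obtain h | h := mem_join.1 h
    · exact hM.1.1 (mem_best.1 h).1
    · exact hN.1.1 (mem_best.1 h).1
  · rintro ⟨a, b⟩ h ⟨a', b'⟩ h' (rfl : a = a')
    obtain h | h := mem_join.1 h <;> obtain h' | h' := mem_join.1 h'
    · exact hM.1.2.1 _ (mem_best.1 h).1 _ (mem_best.1 h').1 rfl
    · rw [hM.eq_right_of_mem_best hN h h']
    · rw [hN.eq_right_of_mem_best hM h h']
    · exact hN.1.2.1 _ (mem_best.1 h).1 _ (mem_best.1 h').1 rfl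
  · rintro ⟨a, b⟩ h ⟨a', b'⟩ h' (rfl : b = b')
    obtain h | h := mem_join.1 h <;> obtain h' | h' := mem_join.1 h'
    · exact hM.1.2.2 _ (mem_best.1 h).1 _ (mem_best.1 h').1 rfl
    · rw [hM.eq_left_of_mem_best hN h h']
    · rw [hN.eq_left_of_mem_best hM h h']
    · exact hN.1.2.2 _ (mem_best.1 h).1 _ (mem_best.1 h').1 rfl

/-- A woman matched in both `M` and `N` is matched in their join to one of these partners. -/
theorem SuperStable.mem_join_or_mem_join (hM : I.SuperStable M) (hN : I.SuperStable N)
    {a₁ a₂ : A} {b : B} (h₁ : (a₁, b) ∈ M) (h₂ : (a₂, b) ∈ N) :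
    (a₁, b) ∈ I.join M N ∨ (a₂, b) ∈ I.join M N := by
  by_cases h : (a₁, b) ∈ I.best M N
  · exact .inl (mem_join.2 (.inl h))
  have hex : ∃ b', (a₁, b') ∈ N ∧ ¬ I.prefA a₁ b b' := by
    by_contra! hc
    exact h (mem_best.2 ⟨h₁, hc⟩)
  obtain ⟨b', hb', hn⟩ := hex
  have hbest : (a₁, b') ∈ I.best N M := mem_best.2 ⟨hb', fun c hc =>
    hM.1.eq_right h₁ hc ▸ (I.prefA_total _ _ _ (hM.1.1 h₁) (hN.1.1 hb')).resolve_left hn⟩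
  have hnot : (a₁, b') ∉ M := fun hm => by
    obtain rfl := hM.1.eq_right h₁ hm
    exact hn (I.prefA_refl _ _ (hM.1.1 h₁))
  obtain ⟨a₀, b₀, h₀, hb₀, -⟩ := hN.exists_mem_best_of_mem_best hM hbest hnot
  obtain rfl := hM.1.eq_right h₁ hb₀
  obtain rfl := hN.1.eq_left h₂ (mem_best.1 h₀).1
  exact .inr (mem_join.2 (.inr h₀))

/-- A man of an edge blocking the join strictly loses to the partner in `M` of its woman. -/
theorem SuperStable.exists_of_blocks_join (hM : I.SuperStable M) (hN : I.SuperStable N)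
    {a : A} {b : B} (h : I.Blocks (I.join M N) a b) :
    ∃ a', (a', b) ∈ M ∧ ¬ I.prefB b a a' := by
  obtain ⟨hE, hnot, hA, -⟩ := h
  have hpref {L : Finset (A × B)} (hL : I.Dominates (I.join M N) L) (c : B)
      (hc : (a, c) ∈ L) : I.prefA a b c := by
    obtain ⟨d, hd, hp⟩ := hL a c hc
    exact I.prefA_trans _ _ _ _ (hA d hd) hp
  have hbM : (a, b) ∉ M := fun hm => hnot <| mem_join.2 <| .inl <| mem_best.2
    ⟨hm, hpref (join_comm (I := I) ▸ hN.dominates_join_left hM)⟩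
  refine (hM.exists_of_notMem hE hbM).resolve_left ?_
  rintro ⟨c, hc, hn⟩
  exact hn (hpref (hM.dominates_join_left hN) c hc)

theorem SuperStable.join (hM : I.SuperStable M) (hN : I.SuperStable N) :
    I.SuperStable (I.join M N) := by
  refine ⟨hM.isMatching_join hN, fun a b h => ?_⟩
  obtain ⟨a₁, h₁, hn₁⟩ := hM.exists_of_blocks_join hN h
  obtain ⟨a₂, h₂, hn₂⟩ := hN.exists_of_blocks_join hM (join_comm (I := I) (M := M) ▸ h)
  obtain hj | hj := hM.mem_join_or_mem_join hN h₁ h₂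
  · exact hn₁ (h.2.2.2 _ hj)
  · exact hn₂ (h.2.2.2 _ hj)

theorem SuperStable.subset_of_dominates (hM : I.SuperStable M) (hN : I.SuperStable N)
    (h : I.Dominates M N) (h' : I.Dominates N M) : M ⊆ N := by
  rintro ⟨a, b⟩ hab
  by_contra hb
  have hbest : (a, b) ∈ I.best M N := by
    refine mem_best.2 ⟨hab, fun c hc => ?_⟩
    obtain ⟨d, hd, hp⟩ := h a c hc
    exact hM.1.eq_right hab hd ▸ hp
  obtain ⟨a', b', h₁, h₂, hn, -⟩ := hM.exists_of_mem_best hN hbest hb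
  obtain ⟨c, hc, hp⟩ := h' a' b' h₂
  exact hn (hN.1.eq_right h₁ hc ▸ hp)

theorem exists_superStable_dominates (h : ∃ M, I.SuperStable M) :
    ∃ M₀, I.SuperStable M₀ ∧ ∀ N, I.SuperStable N → I.Dominates M₀ N := by
  have key (S : Finset (Finset (A × B))) :
      ∃ M₀, I.SuperStable M₀ ∧ ∀ N ∈ S, I.SuperStable N → I.Dominates M₀ N := by
    induction S using Finset.induction_on with
    | empty => simpa using h
    | insert L S _ ih =>
      obtain ⟨M, hM, hdom⟩ := ih
      by_cases hL : I.SuperStable L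
      · refine ⟨I.join M L, hM.join hL, fun N hN hNs => ?_⟩
        obtain rfl | hN := Finset.mem_insert.1 hN
        · exact join_comm (I := I) ▸ hNs.dominates_join_left hM
        · exact (hM.dominates_join_left hL).trans (hdom N hN hNs)
      · refine ⟨M, hM, fun N hN hNs => ?_⟩
        obtain rfl | hN := Finset.mem_insert.1 hN
        · exact absurd hNs hL
        · exact hdom N hN hNs
  obtain ⟨M₀, hM₀, hdom⟩ := key I.E.powerset
  exact ⟨M₀, hM₀, fun N hN => hdom N (Finset.mem_powerset.2 hN.1.1) hN⟩

end SMInstance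

/-- If an instance of the super-stable matching problem admits at least one
super-stable matching, then there is a unique super-stable matching `M₀` (the
man-optimal one) that dominates every super-stable matching of the instance. -/
theorem man_optimal_super_stable_exists_unique {A B : Type*} (I : SMInstance A B)
    (h : ∃ M, I.SuperStable M) :
    ∃! M₀ : Finset (A × B),
      I.SuperStable M₀ ∧ ∀ N, I.SuperStable N → I.Dominates M₀ N := by
  obtain ⟨M₀, hM₀, hdom⟩ := SMInstance.exists_superStable_dominates h
  refine ⟨M₀, ⟨hM₀, hdom⟩, fun M ⟨hM, hMdom⟩ => ?_⟩
  exact (hM.subset_of_dominates hM₀ (hMdom M₀ hM₀) (hdom M hM)).antisymm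
    (hM₀.subset_of_dominates hM (hdom M hM) (hMdom M₀ hM₀))
end

section
/- Let M and N be two super-stable matchings of a super-stable matching instance. If (p,q) ∈ M and (p,q') ∈ N where p is indifferent between q and q' (q =_p q'), then q = q'. -/
open scoped Classical

namespace SMInstance

variable {A B : Type*}

/-- An `M`-edge `(a, b)` outside `N` that `a` weakly prefers to its `N`-partner, if any. -/
def WeaklyImproves (I : SMInstance A B) (N : Finset (A × B)) (e : A × B) : Prop :=
  e ∉ N ∧ ∀ b, (e.1, b) ∈ N → I.prefA e.1 e.2 b

/-- Following an improving `M`-edge and then the `N`-edge at its woman reaches a man whose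
`M`-edge is a strict improvement over that `N`-edge. -/
theorem SuperStable.exists_strict_improvement {I : SMInstance A B} {M N : Finset (A × B)}
    (hM : I.SuperStable M) (hN : I.SuperStable N) {e : A × B} (he : e ∈ M)
    (himp : I.WeaklyImproves N e) :
    ∃ f ∈ M, I.WeaklyImproves N f ∧ (f.1, e.2) ∈ N ∧ ¬ I.prefA f.1 e.2 f.2 := by
  obtain ⟨a, b⟩ := e
  obtain ⟨⟨hME, -, hMB⟩, hMstable⟩ := hM
  obtain ⟨⟨hNE, hNA, -⟩, hNstable⟩ := hN
  obtain ⟨heN, hpref⟩ := himp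
  obtain ⟨a', ha'N, ha'⟩ : ∃ a', (a', b) ∈ N ∧ ¬ I.prefB b a a' := by
    by_contra! h
    exact hNstable a b ⟨hME he, heN, hpref, h⟩
  have ha'M : (a', b) ∉ M := fun h => by
    have hEq := hMB _ h _ he rfl
    exact heN (hEq ▸ ha'N)
  obtain ⟨b', hb'M, hb'⟩ : ∃ b', (a', b') ∈ M ∧ ¬ I.prefA a' b b' := by
    by_contra! h
    refine hMstable a' b ⟨hNE ha'N, ha'M, h, fun a'' ha'' => ?_⟩
    obtain rfl : a'' = a := congrArg Prod.fst (hMB _ ha'' _ he rfl)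
    exact (I.prefB_total b a'' a' (hME he) (hNE ha'N)).resolve_left ha'
  refine ⟨(a', b'), hb'M, ⟨fun h => ?_, fun c hc => ?_⟩, ha'N, hb'⟩
  · have hEq := hNA _ h _ ha'N rfl
    exact ha'M (hEq ▸ hb'M)
  · obtain rfl : c = b := congrArg Prod.snd (hNA _ hc _ ha'N rfl)
    exact (I.prefA_total a' c b' (hNE hc) (hME hb'M)).resolve_left hb'

/-- No `M`-edge outside `N` merely ties with the `N`-edge of the same man: an improving `M`-edge
is a strict improvement over an existing `N`-edge. -/
theorem SuperStable.exists_not_prefA {I : SMInstance A B} {M N : Finset (A × B)}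
    (hM : I.SuperStable M) (hN : I.SuperStable N) {e : A × B} (he : e ∈ M)
    (himp : I.WeaklyImproves N e) :
    ∃ b, (e.1, b) ∈ N ∧ ¬ I.prefA e.1 b e.2 := by
  have hstep : ∀ e, ∃ f, e ∈ M.filter (I.WeaklyImproves N) →
      f ∈ M.filter (I.WeaklyImproves N) ∧ (f.1, e.2) ∈ N ∧ ¬ I.prefA f.1 e.2 f.2 := by
    intro e
    by_cases h : e ∈ M.filter (I.WeaklyImproves N)
    · obtain ⟨heM, heI⟩ := Finset.mem_filter.1 h
      obtain ⟨f, hf, hfI, hfe⟩ := hM.exists_strict_improvement hN heM heI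
      exact ⟨f, fun _ => ⟨Finset.mem_filter.2 ⟨hf, hfI⟩, hfe⟩⟩
    · exact ⟨e, fun h' => absurd h' h⟩
  choose g hg using hstep
  have hinj : Set.InjOn g (M.filter (I.WeaklyImproves N)) := by
    intro x hx y hy hxy
    have hxN := (hg x hx).2.1
    rw [hxy] at hxN
    have hEq := congrArg Prod.snd (hN.1.2.1 _ hxN _ (hg y hy).2.1 rfl)
    exact hM.1.2.2 x (Finset.mem_filter.1 hx).1 y (Finset.mem_filter.1 hy).1 hEq
  have hsurj := Finset.surjOn_of_injOn_of_card_le g (fun x hx => (hg x hx).1) hinj le_rfl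
  obtain ⟨x, hx, rfl⟩ := hsurj (Finset.mem_filter.2 ⟨he, himp⟩)
  exact ⟨x.2, (hg x hx).2⟩

end SMInstance

/-- If `(p,q) ∈ M` and `(p,q') ∈ N` for super-stable matchings `M, N`, and `p` is
indifferent between `q` and `q'`, then `q = q'`. -/
theorem indifferent_partners_equal {A B : Type*} (I : SMInstance A B)
    (M N : Finset (A × B)) (hM : I.SuperStable M) (hN : I.SuperStable N)
    (p : A) (q q' : B) (hq : (p, q) ∈ M) (hq' : (p, q') ∈ N)
    (htie : I.prefA p q q' ∧ I.prefA p q' q) :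
    q = q' := by
  by_contra hne
  have hpartner : ∀ b, (p, b) ∈ N → b = q' := fun b hb =>
    congrArg Prod.snd (hN.1.2.1 _ hb _ hq' rfl)
  have himp : I.WeaklyImproves N (p, q) :=
    ⟨fun h => hne (hpartner q h), fun b hb => hpartner b hb ▸ htie.1⟩
  obtain ⟨b, hb, hnot⟩ := hM.exists_not_prefA hN hq himp
  exact hnot (hpartner b hb ▸ htie.2)
end

section
/- Let M and N be distinct super-stable matchings of a super-stable matching instance such that M dominates N. Then M strictly dominates N: there exists a man m matched in both with M(m) ≻_m N(m). -/
open scoped Classical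

/-- If `M` and `N` are distinct super-stable matchings and `M` dominates `N`, then
`M` strictly dominates `N`: some man matched in both strictly prefers his `M`-partner. -/
theorem dominates_strictly {A B : Type*} (I : SMInstance A B)
    (M N : Finset (A × B)) (hM : I.SuperStable M) (hN : I.SuperStable N)
    (hne : M ≠ N) (hdom : I.Dominates M N) :
    ∃ (m : A) (w w' : B), (m, w) ∈ M ∧ (m, w') ∈ N ∧ I.SPrefA m w w' := by
  by_contra! hcon
  -- each edge of `M` outside `N` yields an edge of `N` that blocks `M`
  have hsub : ∀ m w, (m, w) ∈ M → (m, w) ∈ N := by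
    intro m w hmw
    by_contra hmwN
    have hwoman : ∃ m', (m', w) ∈ N ∧ ¬ I.prefB w m m' := by
      by_contra! hall
      refine hN.2 m w ⟨hM.1.1 hmw, hmwN, fun b hb => ?_, hall⟩
      obtain ⟨w₁, hw₁, hpref⟩ := hdom m b hb
      obtain rfl : w₁ = w := congrArg Prod.snd (hM.1.2.1 _ hw₁ _ hmw rfl)
      exact hpref
    obtain ⟨m', hm'w, hnot⟩ := hwoman
    have hpref : I.prefB w m' m :=
      (I.prefB_total w m m' (hM.1.1 hmw) (hN.1.1 hm'w)).resolve_left hnot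
    have hunique : ∀ a, (a, w) ∈ M → a = m := fun a ha =>
      congrArg Prod.fst (hM.1.2.2 _ ha _ hmw rfl)
    refine hM.2 m' w ⟨hN.1.1 hm'w, fun h => hmwN (hunique m' h ▸ hm'w), fun b hb => ?_,
      fun a ha => hunique a ha ▸ hpref⟩
    obtain ⟨b', hb', hb'w⟩ := hdom m' w hm'w
    obtain rfl : b' = b := congrArg Prod.snd (hM.1.2.1 _ hb' _ hb rfl)
    by_contra hstrict
    exact hcon m' b' w hb hm'w ⟨hb'w, hstrict⟩
  refine hne (Finset.Subset.antisymm (fun p hp => hsub p.1 p.2 hp) fun p hp => ?_)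
  obtain ⟨w, hw, -⟩ := hdom p.1 p.2 hp
  exact hN.1.2.1 _ (hsub _ _ hw) _ hp rfl ▸ hw
end

section
/- Let (m,w) ∈ E and let M be a super-stable matching of G containing the edge (m,w). Then M' = M \ {(m,w)} is a super-stable matching of the reduced graph G'. -/
open scoped Classical

namespace SMInstance

/-- The reduced graph `G'` for an edge `(m,w)`: delete the vertices `m` and `w`
(with all incident edges), every edge `(m',w')` such that `(m',w) ∈ E` with
`m' ⪰_w m` and `w ⪰_{m'} w'`, and every edge `(m',w')` such that `(m,w') ∈ E` with
`w' ⪰_m w` and `m ⪰_{w'} m'`. Preference lists are the restrictions of those of `G`. -/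
noncomputable def reduced {A B : Type*} (I : SMInstance A B) (m : A) (w : B) :
    SMInstance A B where
  E := I.E.filter (fun p =>
    p.1 ≠ m ∧ p.2 ≠ w ∧
    ¬((p.1, w) ∈ I.E ∧ I.prefB w p.1 m ∧ I.prefA p.1 w p.2) ∧
    ¬((m, p.2) ∈ I.E ∧ I.prefA m p.2 w ∧ I.prefB p.2 m p.1))
  prefA := I.prefA
  prefB := I.prefB
  prefA_refl := fun a b hb => I.prefA_refl a b (Finset.mem_filter.mp hb).1
  prefA_trans := I.prefA_trans
  prefA_total := fun a b₁ b₂ h₁ h₂ =>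
    I.prefA_total a b₁ b₂ (Finset.mem_filter.mp h₁).1 (Finset.mem_filter.mp h₂).1
  prefB_refl := fun b a hb => I.prefB_refl b a (Finset.mem_filter.mp hb).1
  prefB_trans := I.prefB_trans
  prefB_total := fun b a₁ a₂ h₁ h₂ =>
    I.prefB_total b a₁ a₂ (Finset.mem_filter.mp h₁).1 (Finset.mem_filter.mp h₂).1

end SMInstance

/-- If `M` is a super-stable matching of `G` containing the edge `(m,w)`, then
`M' = M \ {(m,w)}` is a super-stable matching of the reduced graph `G'`. -/
theorem erase_super_stable_in_reduced {A B : Type*} (I : SMInstance A B)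
    (m : A) (w : B) (hmw : (m, w) ∈ I.E)
    (M : Finset (A × B)) (hM : I.SuperStable M) (hmem : (m, w) ∈ M) :
    (I.reduced m w).SuperStable (M.erase (m, w)) := by
  obtain ⟨⟨hsub, hA, hB⟩, hblock⟩ := hM
  refine ⟨⟨?_, fun p hp q hq => hA p (Finset.mem_of_mem_erase hp) q (Finset.mem_of_mem_erase hq),
    fun p hp q hq => hB p (Finset.mem_of_mem_erase hp) q (Finset.mem_of_mem_erase hq)⟩, ?_⟩
  · rintro ⟨a, b⟩ hp
    obtain ⟨hne, hp⟩ := Finset.mem_erase.mp hp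
    have ham : a ≠ m := fun h => hne (hA _ hp _ hmem h)
    have hbw : b ≠ w := fun h => hne (hB _ hp _ hmem h)
    refine Finset.mem_filter.mpr ⟨hsub hp, ham, hbw, ?_, ?_⟩
    · rintro ⟨hE, hw, ha⟩
      refine hblock a w ⟨hE, fun h => ham (congrArg Prod.fst (hB _ h _ hmem rfl)), ?_, ?_⟩
      · intro b' h
        obtain rfl : b' = b := congrArg Prod.snd (hA _ h _ hp rfl)
        exact ha
      · intro a' h
        obtain rfl : a' = m := congrArg Prod.fst (hB _ h _ hmem rfl)
        exact hw
    · rintro ⟨hE, hm, hb⟩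
      refine hblock m b ⟨hE, fun h => hbw (congrArg Prod.snd (hA _ h _ hmem rfl)), ?_, ?_⟩
      · intro b' h
        obtain rfl : b' = w := congrArg Prod.snd (hA _ h _ hmem rfl)
        exact hm
      · intro a' h
        obtain rfl : a' = a := congrArg Prod.fst (hB _ h _ hp rfl)
        exact hb
  · rintro a b ⟨hE, hn, ha, hb⟩
    obtain ⟨hE, ham, hbw, -⟩ := Finset.mem_filter.mp hE
    refine hblock a b ⟨hE, fun h => hn (Finset.mem_erase.mpr ⟨?_, h⟩), fun b' h => ha b' ?_,
      fun a' h => hb a' ?_⟩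
    · exact fun h => ham (congrArg Prod.fst h)
    · exact Finset.mem_erase.mpr ⟨fun h => ham (congrArg Prod.fst h), h⟩
    · exact Finset.mem_erase.mpr ⟨fun h => hbw (congrArg Prod.snd h), h⟩
end

section
/- Let (m,w) ∈ E and let M' be a super-stable matching of the reduced graph G' such that M' ∪ {(m,w)} is a super-stable matching of G. Then for every super-stable matching N' of G', the matching N' ∪ {(m,w)} is a super-stable matching of G. -/
open scoped Classical

namespace SMInstance

/-- The instance with the roles of men and women exchanged. -/
noncomputable def swap {A B : Type*} (I : SMInstance A B) : SMInstance B A where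
  E := I.E.map (Equiv.prodComm A B).toEmbedding
  prefA := I.prefB
  prefB := I.prefA
  prefA_refl := fun b a h => I.prefB_refl b a (by simpa using h)
  prefA_trans := I.prefB_trans
  prefA_total := fun b a₁ a₂ h₁ h₂ => I.prefB_total b a₁ a₂ (by simpa using h₁) (by simpa using h₂)
  prefB_refl := fun a b h => I.prefA_refl a b (by simpa using h)
  prefB_trans := I.prefA_trans
  prefB_total := fun a b₁ b₂ h₁ h₂ => I.prefA_total a b₁ b₂ (by simpa using h₁) (by simpa using h₂)

theorem IsMatching.right_unique {A B : Type*} {I : SMInstance A B} {M : Finset (A × B)}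
    (hM : I.IsMatching M) {a : A} {b b' : B} (h : (a, b) ∈ M) (h' : (a, b') ∈ M) : b = b' :=
  congrArg Prod.snd (hM.2.1 _ h _ h' rfl)

theorem IsMatching.left_unique {A B : Type*} {I : SMInstance A B} {M : Finset (A × B)}
    (hM : I.IsMatching M) {a a' : A} {b : B} (h : (a, b) ∈ M) (h' : (a', b) ∈ M) : a = a' :=
  congrArg Prod.fst (hM.2.2 _ h _ h' rfl)

theorem SuperStable.swap {A B : Type*} {I : SMInstance A B} {M : Finset (A × B)}
    (hM : I.SuperStable M) :
    I.swap.SuperStable (M.map (Equiv.prodComm A B).toEmbedding) := by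
  refine ⟨⟨Finset.map_subset_map.2 hM.1.1, ?_, ?_⟩, ?_⟩
  · rintro ⟨b, a⟩ h ⟨b', a'⟩ h' rfl
    exact Prod.ext rfl (hM.1.left_unique (b := b) (by simpa using h) (by simpa using h'))
  · rintro ⟨b, a⟩ h ⟨b', a'⟩ h' rfl
    exact Prod.ext (hM.1.right_unique (a := a) (by simpa using h) (by simpa using h')) rfl
  · rintro b a ⟨h₁, h₂, h₃, h₄⟩
    exact hM.2 a b ⟨by simpa [SMInstance.swap] using h₁, by simpa using h₂,
      fun b' h => h₄ b' (by simpa using h), fun a' h => h₃ a' (by simpa using h)⟩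

/-- A woman matched in one super-stable matching is matched in every super-stable matching. -/
theorem SuperStable.exists_mem_left {A B : Type*} {I : SMInstance A B} {M N : Finset (A × B)}
    (hM : I.SuperStable M) (hN : I.SuperStable N) {a : A} {b : B} (hab : (a, b) ∈ N) :
    ∃ a', (a', b) ∈ M := by
  by_contra hb
  let S : Set B := {b | ∃ a, (a, b) ∈ N ∧ ∀ a', (a', b) ∈ M → ¬ I.prefB b a' a}
  have hS : S.Finite := (N.image Prod.snd).finite_toSet.subset fun b ⟨a, h, _⟩ => by
    simpa using ⟨a, h⟩
  have step : ∀ b : S, ∃ b' : S, ∃ a, (a, b.1) ∈ N ∧ (a, b'.1) ∈ M := by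
    rintro ⟨b, a, hab, hs⟩
    have hE := hN.1.1 hab
    have habM : (a, b) ∉ M := fun h => hs a h (I.prefB_refl b a hE)
    obtain ⟨b', hb', hbb'⟩ : ∃ b', (a, b') ∈ M ∧ ¬ I.prefA a b b' := by
      by_contra! h
      exact hM.2 a b ⟨hE, habM, h, fun a' h' =>
        (I.prefB_total b a a' hE (hM.1.1 h')).resolve_right (hs a' h')⟩
    have hE' := hM.1.1 hb'
    have hb'N : (a, b') ∉ N := fun h => habM (hN.1.right_unique hab h ▸ hb')
    obtain ⟨a', ha', haa'⟩ : ∃ a', (a', b') ∈ N ∧ ¬ I.prefB b' a a' := by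
      by_contra! h
      refine hN.2 a b' ⟨hE', hb'N, fun c hc => ?_, h⟩
      rw [← hN.1.right_unique hab hc]
      exact (I.prefA_total a b' b hE' hE).resolve_right hbb'
    exact ⟨⟨b', a', ha', fun c hc => by rwa [hM.1.left_unique hc hb']⟩, a, hab, hb'⟩
  choose f g hgN hgM using step
  have : Finite S := hS
  have hf : Function.Injective f := fun b₁ b₂ h => by
    have h₁ := hgM b₁
    rw [h] at h₁
    have hg := hM.1.left_unique h₁ (hgM b₂)
    exact Subtype.ext (hN.1.right_unique (hgN b₁) (hg ▸ hgN b₂))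
  obtain ⟨c, hc⟩ := Finite.surjective_of_injective hf
    ⟨b, a, hab, fun a' h => (hb ⟨a', h⟩).elim⟩
  exact hb ⟨g c, by simpa [hc] using hgM c⟩

/-- A man matched in one super-stable matching is matched in every super-stable matching. -/
theorem SuperStable.exists_mem_right {A B : Type*} {I : SMInstance A B} {M N : Finset (A × B)}
    (hM : I.SuperStable M) (hN : I.SuperStable N) {a : A} {b : B} (hab : (a, b) ∈ N) :
    ∃ b', (a, b') ∈ M := by
  obtain ⟨b', h⟩ := hM.swap.exists_mem_left hN.swap (a := b) (b := a) (by simpa using hab)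
  exact ⟨b', by simpa using h⟩

theorem mem_reduced_E {A B : Type*} {I : SMInstance A B} {m a : A} {w b : B} :
    (a, b) ∈ (I.reduced m w).E ↔ (a, b) ∈ I.E ∧ a ≠ m ∧ b ≠ w ∧
      ¬((a, w) ∈ I.E ∧ I.prefB w a m ∧ I.prefA a w b) ∧
      ¬((m, b) ∈ I.E ∧ I.prefA m b w ∧ I.prefB b m a) := by
  simp [reduced]

end SMInstance

/-- If some super-stable matching `M'` of the reduced graph `G'` is such that
`M' ∪ {(m,w)}` is super-stable in `G`, then for every super-stable matching `N'` of
`G'`, the matching `N' ∪ {(m,w)}` is super-stable in `G`. -/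
theorem reduced_super_stable_extends {A B : Type*} (I : SMInstance A B)
    (m : A) (w : B) (hmw : (m, w) ∈ I.E)
    (M' : Finset (A × B)) (hM' : (I.reduced m w).SuperStable M')
    (hMs : I.SuperStable (insert (m, w) M')) :
    ∀ N', (I.reduced m w).SuperStable N' → I.SuperStable (insert (m, w) N') := by
  intro N' hN
  have hNE : ∀ {a b}, (a, b) ∈ N' → _ := fun h => SMInstance.mem_reduced_E.1 (hN.1.1 h)
  have hME : ∀ {a b}, (a, b) ∈ M' → _ := fun h => SMInstance.mem_reduced_E.1 (hM'.1.1 h)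
  have hm : ∀ b, b ≠ w → (m, b) ∈ I.E → I.prefA m b w →
      ∃ a, (a, b) ∈ N' ∧ ¬ I.prefB b m a := by
    intro b hb hE hp
    by_contra! h
    refine hMs.2 m b ⟨hE, ?_, fun b' hb' => ?_, fun a ha => ?_⟩
    · simpa [hb] using fun h => (hME h).2.1 rfl
    · rcases Finset.mem_insert.1 hb' with e | h'
      · obtain rfl := congrArg Prod.snd e
        exact hp
      · exact ((hME h').2.1 rfl).elim
    · rcases Finset.mem_insert.1 ha with e | h'
      · exact (hb (congrArg Prod.snd e)).elim
      · obtain ⟨c, hc⟩ := hN.exists_mem_left hM' h'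
        exact ((hNE hc).2.2.2.2 ⟨hE, hp, h c hc⟩).elim
  have hw : ∀ a, a ≠ m → (a, w) ∈ I.E → I.prefB w a m →
      ∃ b, (a, b) ∈ N' ∧ ¬ I.prefA a w b := by
    intro a ha hE hp
    by_contra! h
    refine hMs.2 a w ⟨hE, ?_, fun b hb => ?_, fun a' ha' => ?_⟩
    · simpa [ha] using fun h => (hME h).2.2.1 rfl
    · rcases Finset.mem_insert.1 hb with e | h'
      · exact (ha (congrArg Prod.fst e)).elim
      · obtain ⟨c, hc⟩ := hN.exists_mem_right hM' h'
        exact ((hNE hc).2.2.2.1 ⟨hE, hp, h c hc⟩).elim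
    · rcases Finset.mem_insert.1 ha' with e | h'
      · obtain rfl := congrArg Prod.fst e
        exact hp
      · exact ((hME h').2.2.1 rfl).elim
  refine ⟨⟨?_, ?_, ?_⟩, ?_⟩
  · rintro ⟨a, b⟩ h
    rcases Finset.mem_insert.1 h with e | h'
    · exact e ▸ hmw
    · exact (hNE h').1
  · rintro ⟨a, b⟩ h ⟨a', b'⟩ h' rfl
    rcases Finset.mem_insert.1 h with e | h <;> rcases Finset.mem_insert.1 h' with e' | h'
    · exact e.trans e'.symm
    · exact ((hNE h').2.1 (congrArg Prod.fst e)).elim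
    · exact ((hNE h).2.1 (congrArg Prod.fst e')).elim
    · exact hN.1.2.1 _ h _ h' rfl
  · rintro ⟨a, b⟩ h ⟨a', b'⟩ h' rfl
    rcases Finset.mem_insert.1 h with e | h <;> rcases Finset.mem_insert.1 h' with e' | h'
    · exact e.trans e'.symm
    · exact ((hNE h').2.2.1 (congrArg Prod.snd e)).elim
    · exact ((hNE h).2.2.1 (congrArg Prod.snd e')).elim
    · exact hN.1.2.2 _ h _ h' rfl
  · rintro a b ⟨hE, hn, hA, hB⟩
    by_cases ha : a = m
    · subst ha
      have hb : b ≠ w := by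
        rintro rfl
        exact hn (Finset.mem_insert_self _ _)
      obtain ⟨c, hc, hcp⟩ := hm b hb hE (hA w (Finset.mem_insert_self _ _))
      exact hcp (hB c (Finset.mem_insert_of_mem hc))
    by_cases hb : b = w
    · subst hb
      obtain ⟨c, hc, hcp⟩ := hw a ha hE (hB m (Finset.mem_insert_self _ _))
      exact hcp (hA c (Finset.mem_insert_of_mem hc))
    refine hN.2 a b ⟨SMInstance.mem_reduced_E.2 ⟨hE, ha, hb, ?_, ?_⟩,
      fun h => hn (Finset.mem_insert_of_mem h),
      fun b' h => hA b' (Finset.mem_insert_of_mem h),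
      fun a' h => hB a' (Finset.mem_insert_of_mem h)⟩
    · rintro ⟨h₁, h₂, h₃⟩
      obtain ⟨c, hc, hcp⟩ := hw a ha h₁ h₂
      exact hcp (I.prefA_trans _ _ _ _ h₃ (hA c (Finset.mem_insert_of_mem hc)))
    · rintro ⟨h₁, h₂, h₃⟩
      obtain ⟨c, hc, hcp⟩ := hm b hb h₁ h₂
      exact hcp (I.prefB_trans _ _ _ _ h₃ (hB c (Finset.mem_insert_of_mem hc)))
end

section
/- Let (m,w) ∈ E. There exists a super-stable (m,w)-matching in G if and only if the reduced graph G' admits a super-stable matching M' such that M' ∪ {(m,w)} is super-stable in G. Moreover, if M₀' is the man-optimal super-stable matching of G' and M₀' ∪ {(m,w)} is super-stable in G, then M₀' ∪ {(m,w)} dominates every super-stable (m,w)-matching of G (it is the man-optimal super-stable (m,w)-matching). -/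
open scoped Classical

namespace SMInstance

/-- Removing `(m, w)` from a super-stable `(m, w)`-matching of `G` leaves a super-stable
matching of the reduced graph. -/
theorem SuperStable.reduced_erase {A B : Type*} {I : SMInstance A B} {m : A} {w : B}
    {N : Finset (A × B)} (hN : I.SuperStable N) (hmw : (m, w) ∈ N) :
    (I.reduced m w).SuperStable (N.erase (m, w)) := by
  obtain ⟨⟨hsub, hA, hB⟩, hblock⟩ := hN
  have uniqA : ∀ a b b', (a, b) ∈ N → (a, b') ∈ N → b = b' := fun a b b' h h' =>
    congrArg Prod.snd (hA _ h _ h' rfl)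
  have uniqB : ∀ a a' b, (a, b) ∈ N → (a', b) ∈ N → a = a' := fun a a' b h h' =>
    congrArg Prod.fst (hB _ h _ h' rfl)
  refine ⟨⟨?_, fun p hp q hq => hA p (Finset.mem_of_mem_erase hp) q (Finset.mem_of_mem_erase hq),
    fun p hp q hq => hB p (Finset.mem_of_mem_erase hp) q (Finset.mem_of_mem_erase hq)⟩, ?_⟩
  · rintro ⟨a, b⟩ hp
    obtain ⟨hne, hab⟩ := Finset.mem_erase.mp hp
    have ham : a ≠ m := by
      rintro rfl
      exact hne (hA _ hab _ hmw rfl)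
    have hbw : b ≠ w := by
      rintro rfl
      exact hne (hB _ hab _ hmw rfl)
    refine Finset.mem_filter.mpr ⟨hsub hab, ham, hbw, ?_, ?_⟩
    · rintro ⟨hE, hw, ha⟩
      refine hblock a w ⟨hE, fun h => ham (uniqB _ _ _ h hmw), fun b' hb' => ?_, fun a' ha' => ?_⟩
      · rwa [uniqA _ _ _ hb' hab]
      · rwa [uniqB _ _ _ ha' hmw]
    · rintro ⟨hE, hm, hb⟩
      refine hblock m b ⟨hE, fun h => hbw (uniqA _ _ _ h hmw), fun b' hb' => ?_, fun a' ha' => ?_⟩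
      · rwa [uniqA _ _ _ hb' hmw]
      · rwa [uniqB _ _ _ ha' hab]
  · rintro a b ⟨hE, hab, ha, hb⟩
    obtain ⟨hE, ham, hbw, -⟩ := Finset.mem_filter.mp hE
    have mem_erase : ∀ a' b', a' ≠ m ∨ b' ≠ w → (a', b') ∈ N → (a', b') ∈ N.erase (m, w) := by
      intro a' b' h h'
      refine Finset.mem_erase.mpr ⟨fun heq => ?_, h'⟩
      obtain ⟨rfl, rfl⟩ := Prod.mk.inj heq
      simp at h
    exact hblock a b ⟨hE, fun h => hab (mem_erase _ _ (.inl ham) h),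
      fun b' h => ha b' (mem_erase _ _ (.inl ham) h),
      fun a' h => hb a' (mem_erase _ _ (.inr hbw) h)⟩

end SMInstance

/-- There exists a super-stable `(m,w)`-matching in `G` iff the reduced graph `G'`
admits a super-stable matching `M'` with `M' ∪ {(m,w)}` super-stable in `G`.
Moreover, if `M₀'` is the man-optimal super-stable matching of `G'` and
`M₀' ∪ {(m,w)}` is super-stable in `G`, then `M₀' ∪ {(m,w)}` dominates every
super-stable `(m,w)`-matching of `G`. -/
theorem man_optimal_mw_matching {A B : Type*} (I : SMInstance A B)
    (m : A) (w : B) (hmw : (m, w) ∈ I.E) :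
    ((∃ M, I.SuperStable M ∧ (m, w) ∈ M) ↔
      (∃ M', (I.reduced m w).SuperStable M' ∧ I.SuperStable (insert (m, w) M'))) ∧
    (∀ M₀', (I.reduced m w).SuperStable M₀' →
      (∀ N', (I.reduced m w).SuperStable N' → (I.reduced m w).Dominates M₀' N') →
      I.SuperStable (insert (m, w) M₀') →
      ∀ N, I.SuperStable N → (m, w) ∈ N → I.Dominates (insert (m, w) M₀') N) := by
  refine ⟨⟨?_, ?_⟩, ?_⟩
  · rintro ⟨M, hM, hmem⟩
    exact ⟨M.erase (m, w), hM.reduced_erase hmem, by rwa [Finset.insert_erase hmem]⟩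
  · rintro ⟨M', -, hM'⟩
    exact ⟨_, hM', Finset.mem_insert_self _ _⟩
  · intro M₀' _ hopt _ N hN hmem a b hab
    by_cases heq : (a, b) = (m, w)
    · obtain ⟨rfl, rfl⟩ := Prod.mk.inj heq
      exact ⟨b, Finset.mem_insert_self _ _, I.prefA_refl a b hmw⟩
    · obtain ⟨b', hb', hpref⟩ :=
        hopt _ (hN.reduced_erase hmem) a b (Finset.mem_erase.mpr ⟨heq, hab⟩)
      exact ⟨b', Finset.mem_insert_of_mem hb', hpref⟩
end

section
/- The super-stable matching polytope is integral: a vector x ∈ ℝ^E is an extreme point of the polytope defined by the super-stable matching linear system (a)–(c) if and only if x = χ^M for some super-stable matching M of G. Consequently, this polytope equals the convex hull of the incidence vectors of the super-stable matchings of G. -/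
open scoped Classical

namespace SMInstance

variable {A B : Type*}

/-- The incidence vector `χ^M` of a set of edges `M`. -/
noncomputable def chi (M : Finset (A × B)) : A × B → ℝ :=
  fun p => if p ∈ M then 1 else 0

/-- `∑_{i ∈ N(a)} x_{a,i}`, the sum of `x` over the edges incident to the man `a`. -/
noncomputable def rowSum (I : SMInstance A B) (x : A × B → ℝ) (a : A) : ℝ :=
  ∑ p ∈ I.E.filter (fun p => p.1 = a), x p

/-- `∑_{j ∈ N(b)} x_{j,b}`, the sum of `x` over the edges incident to the woman `b`. -/
noncomputable def colSum (I : SMInstance A B) (x : A × B → ℝ) (b : B) : ℝ :=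
  ∑ p ∈ I.E.filter (fun p => p.2 = b), x p

/-- Constraint (b) of the super-stable matching linear system at edge `p = (u,v)`:
`∑_{i ≻_u v} x_{u,i} + ∑_{j ≻_v u} x_{j,v} + x_{u,v} ≥ 1`. -/
def StabIneq (I : SMInstance A B) (x : A × B → ℝ) (p : A × B) : Prop :=
  (∑ q ∈ I.E.filter (fun q => q.1 = p.1 ∧ I.SPrefA p.1 q.2 p.2), x q) +
  (∑ q ∈ I.E.filter (fun q => q.2 = p.2 ∧ I.SPrefB p.2 q.1 p.1), x q) +
  x p ≥ 1

/-- `x ∈ ℝ^E` is a feasible solution of the super-stable matching linear system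
(a)–(c). -/
def Feasible (I : SMInstance A B) (x : A × B → ℝ) : Prop :=
  (∀ p, p ∉ I.E → x p = 0) ∧
  (∀ a : A, I.rowSum x a ≤ 1) ∧
  (∀ b : B, I.colSum x b ≤ 1) ∧
  (∀ p ∈ I.E, I.StabIneq x p) ∧
  (∀ p, 0 ≤ x p)

end SMInstance

namespace SMInstance

variable {A B : Type*}

/-- The weighted sum of row (or column) totals splits into the diagonal, twice the strictly
comparable pairs, and the incomparable pairs. -/
theorem sum_mul_sum_class_eq {α : Type*} (E : Finset α) (e r : α → α → Prop)
    (e_refl : ∀ p, e p p) (e_symm : ∀ p q, e p q → e q p)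
    (r_asymm : ∀ p q, r p q → ¬ r q p) (r_le : ∀ p q, r p q → e p q) (x : α → ℝ) :
    ∑ p ∈ E, x p * ∑ q ∈ E with e q p, x q =
      ∑ p ∈ E, x p * x p + 2 * ∑ p ∈ E, x p * ∑ q ∈ E with r q p, x q +
      ∑ p ∈ E, ∑ q ∈ E with (e q p ∧ q ≠ p ∧ ¬ r q p ∧ ¬ r p q), x p * x q := by
  have hswap : ∑ p ∈ E, x p * ∑ q ∈ E with r q p, x q =
      ∑ p ∈ E, ∑ q ∈ E, if r p q then x p * x q else 0 := by
    rw [Finset.sum_comm]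
    refine Finset.sum_congr rfl fun p _ => ?_
    rw [Finset.mul_sum, Finset.sum_filter]
    exact Finset.sum_congr rfl fun q _ => by split_ifs <;> ring
  have hdiag : ∑ p ∈ E, x p * x p = ∑ p ∈ E, ∑ q ∈ E, if q = p then x p * x q else 0 := by
    refine Finset.sum_congr rfl fun p hp => ?_
    rw [Finset.sum_ite_eq' E p, if_pos hp]
  rw [two_mul, hdiag]
  nth_rewrite 2 [hswap]
  simp only [Finset.mul_sum, Finset.sum_filter, ← Finset.sum_add_distrib]
  refine Finset.sum_congr rfl fun p _ => Finset.sum_congr rfl fun q _ => ?_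
  have h1 := e_refl p
  have h2 := e_symm p q
  have h3 := r_asymm p q
  have h4 := r_asymm p p
  have h5 := r_le p q
  have h6 := r_le q p
  by_cases hqp : q = p
  · subst hqp
    have h7 : ¬ r q q := fun h => h4 h h
    simp [h1, h7]
  · by_cases r1 : r p q <;> by_cases r2 : r q p <;> by_cases he : e q p <;> simp_all

/-- `q` is an edge at the same man as `p`, and he strictly prefers it. -/
def BetterA (I : SMInstance A B) (q p : A × B) : Prop :=
  q.1 = p.1 ∧ I.SPrefA p.1 q.2 p.2

/-- `q` is an edge at the same woman as `p`, and she strictly prefers it. -/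
def BetterB (I : SMInstance A B) (q p : A × B) : Prop :=
  q.2 = p.2 ∧ I.SPrefB p.2 q.1 p.1

/-- The weight of the edges that the man of `p` strictly prefers to `p`. -/
noncomputable def aboveA (I : SMInstance A B) (x : A × B → ℝ) (p : A × B) : ℝ :=
  ∑ q ∈ I.E with I.BetterA q p, x q

/-- The weight of the edges that the woman of `p` strictly prefers to `p`. -/
noncomputable def aboveB (I : SMInstance A B) (x : A × B → ℝ) (p : A × B) : ℝ :=
  ∑ q ∈ I.E with I.BetterB q p, x q

variable {I : SMInstance A B} {x : A × B → ℝ} {M : Finset (A × B)} {p q s : A × B}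

theorem stabIneq_iff : I.StabIneq x p ↔ 1 ≤ I.aboveA x p + I.aboveB x p + x p := by
  unfold StabIneq aboveA aboveB BetterA BetterB
  rw [ge_iff_le]
  refine Eq.to_iff (congrArg (1 ≤ ·) ?_)
  congr!

theorem BetterA.asymm (h : I.BetterA q p) : ¬ I.BetterA p q := by
  rintro ⟨_, h2, _⟩
  obtain ⟨h3, _, h5⟩ := h
  exact h5 (h3 ▸ h2)

theorem BetterB.asymm (h : I.BetterB q p) : ¬ I.BetterB p q := by
  rintro ⟨_, h2, _⟩
  obtain ⟨h3, _, h5⟩ := h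
  exact h5 (h3 ▸ h2)

theorem BetterA.trans_pref (h : I.BetterA q p) (hps : p.1 = s.1)
    (hp : I.prefA p.1 p.2 s.2) : I.BetterA q s := by
  obtain ⟨h1, h2, h3⟩ := h
  rw [hps] at h1 h2 h3 hp
  exact ⟨h1, I.prefA_trans _ _ _ _ h2 hp, fun h => h3 (I.prefA_trans _ _ _ _ hp h)⟩

theorem BetterB.trans_pref (h : I.BetterB q p) (hps : p.2 = s.2)
    (hp : I.prefB p.2 p.1 s.1) : I.BetterB q s := by
  obtain ⟨h1, h2, h3⟩ := h
  rw [hps] at h1 h2 h3 hp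
  exact ⟨h1, I.prefB_trans _ _ _ _ h2 hp, fun h => h3 (I.prefB_trans _ _ _ _ hp h)⟩

theorem BetterA.trans (h : I.BetterA q p) (h' : I.BetterA p s) : I.BetterA q s :=
  h.trans_pref h'.1 (h'.1 ▸ h'.2.1)

theorem BetterB.trans (h : I.BetterB q p) (h' : I.BetterB p s) : I.BetterB q s :=
  h.trans_pref h'.1 (h'.1 ▸ h'.2.1)

theorem aboveA_nonneg (hx : ∀ p, 0 ≤ x p) (p : A × B) : 0 ≤ I.aboveA x p :=
  Finset.sum_nonneg fun q _ => hx q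

theorem aboveB_nonneg (hx : ∀ p, 0 ≤ x p) (p : A × B) : 0 ≤ I.aboveB x p :=
  Finset.sum_nonneg fun q _ => hx q

theorem aboveB_mono (hx : ∀ p, 0 ≤ x p) (h : ∀ s, I.BetterB s p → I.BetterB s q) :
    I.aboveB x p ≤ I.aboveB x q :=
  Finset.sum_le_sum_of_subset_of_nonneg
    (Finset.monotone_filter_right _ fun s _ => h s) fun s _ _ => hx s

theorem aboveA_add_le (hx : ∀ p, 0 ≤ x p) (hq : q ∈ I.E) (h : I.BetterA q p) :
    I.aboveA x q + x q ≤ I.aboveA x p := by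
  have hnot : q ∉ I.E.filter (fun s => I.BetterA s q) := fun hm =>
    (Finset.mem_filter.1 hm).2.asymm (Finset.mem_filter.1 hm).2
  unfold aboveA
  rw [add_comm, ← Finset.sum_insert hnot]
  refine Finset.sum_le_sum_of_subset_of_nonneg (fun s hs => ?_) fun s _ _ => hx s
  rcases Finset.mem_insert.1 hs with rfl | hs
  · exact Finset.mem_filter.2 ⟨hq, h⟩
  · exact Finset.mem_filter.2 ⟨(Finset.mem_filter.1 hs).1, (Finset.mem_filter.1 hs).2.trans h⟩

theorem aboveB_add_le (hx : ∀ p, 0 ≤ x p) (hq : q ∈ I.E) (h : I.BetterB q p) :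
    I.aboveB x q + x q ≤ I.aboveB x p := by
  have hnot : q ∉ I.E.filter (fun s => I.BetterB s q) := fun hm =>
    (Finset.mem_filter.1 hm).2.asymm (Finset.mem_filter.1 hm).2
  unfold aboveB
  rw [add_comm, ← Finset.sum_insert hnot]
  refine Finset.sum_le_sum_of_subset_of_nonneg (fun s hs => ?_) fun s _ _ => hx s
  rcases Finset.mem_insert.1 hs with rfl | hs
  · exact Finset.mem_filter.2 ⟨hq, h⟩
  · exact Finset.mem_filter.2 ⟨(Finset.mem_filter.1 hs).1, (Finset.mem_filter.1 hs).2.trans h⟩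

theorem aboveA_le_rowSum (hx : ∀ p, 0 ≤ x p) (p : A × B) : I.aboveA x p ≤ I.rowSum x p.1 :=
  Finset.sum_le_sum_of_subset_of_nonneg
    (Finset.monotone_filter_right _ fun _ _ hs => hs.1)
    fun s _ _ => hx s

theorem aboveB_le_colSum (hx : ∀ p, 0 ≤ x p) (p : A × B) : I.aboveB x p ≤ I.colSum x p.2 :=
  Finset.sum_le_sum_of_subset_of_nonneg
    (Finset.monotone_filter_right _ fun _ _ hs => hs.1)
    fun s _ _ => hx s

/-- Self-duality of the linear system: on the support of a feasible point the degree
constraints and the stability constraint are tight, and there are no ties. -/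
theorem Feasible.slackness (hx : I.Feasible x) (hp : p ∈ I.E) (hpos : 0 < x p) :
    I.rowSum x p.1 = 1 ∧ I.colSum x p.2 = 1 ∧ I.aboveA x p + I.aboveB x p + x p = 1 ∧
    (∀ q ∈ I.E, 0 < x q → q.1 = p.1 → q ≠ p → I.BetterA q p ∨ I.BetterA p q) ∧
    (∀ q ∈ I.E, 0 < x q → q.2 = p.2 → q ≠ p → I.BetterB q p ∨ I.BetterB p q) := by
  obtain ⟨-, hrow, hcol, hstab, h0⟩ := hx
  have hA := sum_mul_sum_class_eq I.E (fun q p => q.1 = p.1) I.BetterA (fun _ => rfl)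
    (fun _ _ h => h.symm) (fun _ _ h => h.asymm) (fun _ _ h => h.1) x
  have hB := sum_mul_sum_class_eq I.E (fun q p => q.2 = p.2) I.BetterB (fun _ => rfl)
    (fun _ _ h => h.symm) (fun _ _ h => h.asymm) (fun _ _ h => h.1) x
  set tieA : A × B → Finset (A × B) := fun p =>
    I.E.filter fun q => q.1 = p.1 ∧ q ≠ p ∧ ¬ I.BetterA q p ∧ ¬ I.BetterA p q with htA
  set tieB : A × B → Finset (A × B) := fun p =>
    I.E.filter fun q => q.2 = p.2 ∧ q ≠ p ∧ ¬ I.BetterB q p ∧ ¬ I.BetterB p q with htB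
  have hA' : ∑ p ∈ I.E, x p * I.rowSum x p.1 = ∑ p ∈ I.E, x p * x p +
      2 * ∑ p ∈ I.E, x p * I.aboveA x p + ∑ p ∈ I.E, ∑ q ∈ tieA p, x p * x q := by
    unfold rowSum aboveA
    convert hA using 3
    exact Finset.sum_congr (by simp only [htA]; congr!) fun _ _ => rfl
  have hB' : ∑ p ∈ I.E, x p * I.colSum x p.2 = ∑ p ∈ I.E, x p * x p +
      2 * ∑ p ∈ I.E, x p * I.aboveB x p + ∑ p ∈ I.E, ∑ q ∈ tieB p, x p * x q := by
    unfold colSum aboveB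
    convert hB using 3
    exact Finset.sum_congr (by simp only [htB]; congr!) fun _ _ => rfl
  have hzero : ∑ p ∈ I.E, (x p * (1 - I.rowSum x p.1) + x p * (1 - I.colSum x p.2) +
      2 * (x p * (I.aboveA x p + I.aboveB x p + x p - 1)) +
      ∑ q ∈ tieA p, x p * x q + ∑ q ∈ tieB p, x p * x q) = 0 := by
    simp only [mul_sub, mul_add, mul_one, Finset.sum_add_distrib, Finset.sum_sub_distrib,
      ← Finset.mul_sum] at hA' hB' ⊢
    linarith
  have hr (p : A × B) : 0 ≤ x p * (1 - I.rowSum x p.1) :=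
    mul_nonneg (h0 p) (sub_nonneg.2 (hrow _))
  have hc (p : A × B) : 0 ≤ x p * (1 - I.colSum x p.2) :=
    mul_nonneg (h0 p) (sub_nonneg.2 (hcol _))
  have hs (p : A × B) (hp : p ∈ I.E) : 0 ≤ x p * (I.aboveA x p + I.aboveB x p + x p - 1) :=
    mul_nonneg (h0 p) (sub_nonneg.2 (stabIneq_iff.1 (hstab p hp)))
  have hta (p : A × B) : 0 ≤ ∑ q ∈ tieA p, x p * x q :=
    Finset.sum_nonneg fun q _ => mul_nonneg (h0 p) (h0 q)
  have htb (p : A × B) : 0 ≤ ∑ q ∈ tieB p, x p * x q :=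
    Finset.sum_nonneg fun q _ => mul_nonneg (h0 p) (h0 q)
  have hterm := (Finset.sum_eq_zero_iff_of_nonneg (fun p hp => by
    linarith [hr p, hc p, hs p hp, hta p, htb p])).1 hzero p hp
  have hr0 : x p * (1 - I.rowSum x p.1) = 0 := by
    linarith [hr p, hc p, hs p hp, hta p, htb p]
  have hc0 : x p * (1 - I.colSum x p.2) = 0 := by
    linarith [hr p, hc p, hs p hp, hta p, htb p]
  have hs0 : x p * (I.aboveA x p + I.aboveB x p + x p - 1) = 0 := by
    linarith [hr p, hc p, hs p hp, hta p, htb p]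
  have hta0 : ∑ q ∈ tieA p, x p * x q = 0 := by
    linarith [hr p, hc p, hs p hp, hta p, htb p]
  have htb0 : ∑ q ∈ tieB p, x p * x q = 0 := by
    linarith [hr p, hc p, hs p hp, hta p, htb p]
  have hne := hpos.ne'
  refine ⟨?_, ?_, ?_, fun q hq hqpos hqp hqne => ?_, fun q hq hqpos hqp hqne => ?_⟩
  · linarith [(mul_eq_zero.1 hr0).resolve_left hne]
  · linarith [(mul_eq_zero.1 hc0).resolve_left hne]
  · linarith [(mul_eq_zero.1 hs0).resolve_left hne]
  · by_contra! hcon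
    have := (Finset.sum_eq_zero_iff_of_nonneg fun q _ => mul_nonneg (h0 p) (h0 q)).1 hta0 q
      (Finset.mem_filter.2 ⟨hq, hqp, hqne, hcon.1, hcon.2⟩)
    exact (mul_pos hpos hqpos).ne' this
  · by_contra! hcon
    have := (Finset.sum_eq_zero_iff_of_nonneg fun q _ => mul_nonneg (h0 p) (h0 q)).1 htb0 q
      (Finset.mem_filter.2 ⟨hq, hqp, hqne, hcon.1, hcon.2⟩)
    exact (mul_pos hpos hqpos).ne' this

/-- The man-optimal edges of the support of `x`. -/
noncomputable def topEdges (I : SMInstance A B) (x : A × B → ℝ) : Finset (A × B) :=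
  I.E.filter fun p => 0 < x p ∧ I.aboveA x p = 0

theorem mem_topEdges : p ∈ I.topEdges x ↔ p ∈ I.E ∧ 0 < x p ∧ I.aboveA x p = 0 := by
  simp [topEdges]

theorem Feasible.aboveB_add_eq_one (hx : I.Feasible x) (hp : p ∈ I.topEdges x) :
    I.aboveB x p + x p = 1 := by
  obtain ⟨hE, hpos, h⟩ := mem_topEdges.1 hp
  linarith [(hx.slackness hE hpos).2.2.1]

theorem Feasible.exists_topEdges_row (hx : I.Feasible x) (hp : p ∈ I.E) (hpos : 0 < x p) :
    ∃ q ∈ I.topEdges x, q.1 = p.1 := by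
  obtain ⟨q, hq, hmin⟩ := Finset.exists_min_image
    (I.E.filter fun q => 0 < x q ∧ q.1 = p.1) (I.aboveA x)
    ⟨p, Finset.mem_filter.2 ⟨hp, hpos, rfl⟩⟩
  obtain ⟨hqE, hqpos, hqp⟩ := Finset.mem_filter.1 hq
  refine ⟨q, mem_topEdges.2 ⟨hqE, hqpos, ?_⟩, hqp⟩
  have h0 := hx.2.2.2.2
  refine Finset.sum_eq_zero fun s hs => le_antisymm (not_lt.1 fun hspos => ?_) (h0 s)
  obtain ⟨hsE, hsq⟩ := Finset.mem_filter.1 hs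
  linarith [hmin s (Finset.mem_filter.2 ⟨hsE, hspos, hsq.1.trans hqp⟩),
    aboveA_add_le h0 hsE hsq]

theorem Feasible.exists_topEdges_col (hx : I.Feasible x) (hp : p ∈ I.E) (hpos : 0 < x p) :
    ∃ q ∈ I.topEdges x, q.2 = p.2 := by
  obtain ⟨q, hq, hmin⟩ := Finset.exists_min_image
    (I.E.filter fun q => 0 < x q ∧ q.2 = p.2) (I.aboveA x)
    ⟨p, Finset.mem_filter.2 ⟨hp, hpos, rfl⟩⟩
  obtain ⟨hqE, hqpos, hqp⟩ := Finset.mem_filter.1 hq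
  have h0 := hx.2.2.2.2
  obtain ⟨-, hcol, htight, -, htie⟩ := hx.slackness hqE hqpos
  refine ⟨q, mem_topEdges.2 ⟨hqE, hqpos, ?_⟩, hqp⟩
  have hnot : q ∉ I.E.filter (fun s => I.BetterB s q) := fun hm =>
    (Finset.mem_filter.1 hm).2.asymm (Finset.mem_filter.1 hm).2
  suffices h : I.colSum x q.2 = x q + I.aboveB x q by linarith
  unfold colSum aboveB
  rw [← Finset.sum_insert hnot]
  symm
  refine Finset.sum_subset (fun s hs => ?_) fun s hs hs' => ?_
  · rcases Finset.mem_insert.1 hs with rfl | hs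
    · exact Finset.mem_filter.2 ⟨hqE, rfl⟩
    · exact Finset.mem_filter.2 ⟨(Finset.mem_filter.1 hs).1, (Finset.mem_filter.1 hs).2.1⟩
  · obtain ⟨hsE, hsq⟩ := Finset.mem_filter.1 hs
    refine le_antisymm (not_lt.1 fun hspos => ?_) (h0 s)
    have hne : s ≠ q := fun h => hs' (Finset.mem_insert.2 (Or.inl h))
    rcases htie s hsE hspos hsq hne with h | h
    · exact hs' (Finset.mem_insert.2 (Or.inr (Finset.mem_filter.2 ⟨hsE, h⟩)))
    · linarith [hmin s (Finset.mem_filter.2 ⟨hsE, hspos, hsq.trans hqp⟩),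
        aboveB_add_le h0 hqE h, (hx.slackness hsE hspos).2.2.1]

theorem Feasible.isMatching_topEdges (hx : I.Feasible x) : I.IsMatching (I.topEdges x) := by
  have h0 := hx.2.2.2.2
  refine ⟨Finset.filter_subset _ _, fun p hp q hq hpq => ?_, fun p hp q hq hpq => ?_⟩
  all_goals
    by_contra hne
    obtain ⟨hpE, hppos, hp0⟩ := mem_topEdges.1 hp
    obtain ⟨hqE, hqpos, hq0⟩ := mem_topEdges.1 hq
  · rcases (hx.slackness hqE hqpos).2.2.2.1 p hpE hppos hpq hne with h | h
    · linarith [aboveA_add_le h0 hpE h]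
    · linarith [aboveA_add_le h0 hqE h]
  · have hp1 := hx.aboveB_add_eq_one hp
    have hq1 := hx.aboveB_add_eq_one hq
    rcases (hx.slackness hqE hqpos).2.2.2.2 p hpE hppos hpq hne with h | h
    · linarith [aboveB_add_le h0 hpE h]
    · linarith [aboveB_add_le h0 hqE h]

theorem Feasible.superStable_topEdges (hx : I.Feasible x) : I.SuperStable (I.topEdges x) := by
  have h0 := hx.2.2.2.2
  refine ⟨hx.isMatching_topEdges, ?_⟩
  rintro a b ⟨hE, hM, hA, hB⟩
  have hSA : I.aboveA x (a, b) = 0 := by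
    refine Finset.sum_eq_zero fun s hs => le_antisymm (not_lt.1 fun hspos => ?_) (h0 s)
    obtain ⟨hsE, hs⟩ := Finset.mem_filter.1 hs
    obtain ⟨⟨u, v⟩, hq, hqa⟩ := hx.exists_topEdges_row hsE hspos
    obtain rfl : u = a := hqa.trans hs.1
    have := aboveA_add_le h0 hsE (hs.trans_pref (s := (u, v)) rfl (hA v hq))
    linarith [(mem_topEdges.1 hq).2.2, aboveA_nonneg (I := I) h0 s]
  have hSB : I.aboveB x (a, b) < 1 := by
    by_cases hex : ∃ a', (a', b) ∈ I.topEdges x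
    · obtain ⟨a', hq⟩ := hex
      have : I.aboveB x (a, b) ≤ I.aboveB x (a', b) :=
        aboveB_mono h0 fun s hs => hs.trans_pref rfl (hB a' hq)
      linarith [hx.aboveB_add_eq_one hq, (mem_topEdges.1 hq).2.1]
    · refine lt_of_eq_of_lt ?_ one_pos
      refine Finset.sum_eq_zero fun s hs => le_antisymm (not_lt.1 fun hspos => ?_) (h0 s)
      obtain ⟨hsE, hs⟩ := Finset.mem_filter.1 hs
      obtain ⟨⟨u, v⟩, hq, hqb⟩ := hx.exists_topEdges_col hsE hspos
      obtain rfl : v = b := hqb.trans hs.1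
      exact hex ⟨u, hq⟩
  have hval := stabIneq_iff.1 (hx.2.2.2.1 _ hE)
  exact hM (mem_topEdges.2 ⟨hE, by linarith, hSA⟩)

theorem chi_nonneg (M : Finset (A × B)) (p : A × B) : 0 ≤ chi M p := by
  unfold chi
  split_ifs <;> norm_num

theorem chi_of_mem (h : p ∈ M) : chi M p = 1 := if_pos h

theorem chi_of_notMem (h : p ∉ M) : chi M p = 0 := if_neg h

theorem sum_chi_le_one {T : Finset (A × B)} (h : ∀ p ∈ T, ∀ q ∈ T, p ∈ M → q ∈ M → p = q) :
    ∑ p ∈ T, chi M p ≤ 1 := by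
  unfold chi
  rw [Finset.sum_boole]
  have : (T.filter (· ∈ M)).card ≤ 1 := Finset.card_le_one.2 fun p hp q hq =>
    h p (Finset.mem_filter.1 hp).1 q (Finset.mem_filter.1 hq).1 (Finset.mem_filter.1 hp).2
      (Finset.mem_filter.1 hq).2
  exact_mod_cast this

theorem one_le_sum_of_chi {T : Finset (A × B)} (hp : p ∈ T) (hM : p ∈ M) :
    1 ≤ ∑ q ∈ T, chi M q :=
  (chi_of_mem hM).ge.trans (Finset.single_le_sum (fun q _ => chi_nonneg M q) hp)

theorem SuperStable.feasible_chi (hM : I.SuperStable M) : I.Feasible (chi M) := by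
  obtain ⟨⟨hME, hrow, hcol⟩, hstab⟩ := hM
  refine ⟨fun p hp => chi_of_notMem fun h => hp (hME h), fun a => ?_, fun b => ?_,
    fun p hp => stabIneq_iff.2 ?_, chi_nonneg M⟩
  · exact sum_chi_le_one fun p hp q hq hpM hqM =>
      hrow p hpM q hqM ((Finset.mem_filter.1 hp).2.trans (Finset.mem_filter.1 hq).2.symm)
  · exact sum_chi_le_one fun p hp q hq hpM hqM =>
      hcol p hpM q hqM ((Finset.mem_filter.1 hp).2.trans (Finset.mem_filter.1 hq).2.symm)
  · have hA := aboveA_nonneg (I := I) (chi_nonneg M) p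
    have hB := aboveB_nonneg (I := I) (chi_nonneg M) p
    have h0 := chi_nonneg M p
    by_cases hpM : p ∈ M
    · linarith [chi_of_mem hpM]
    obtain ⟨a, b⟩ := p
    by_cases h : ∀ b', (a, b') ∈ M → I.prefA a b b'
    · have h' : ¬ ∀ a', (a', b) ∈ M → I.prefB b a a' := fun h' => hstab a b ⟨hp, hpM, h, h'⟩
      push Not at h'
      obtain ⟨a', ha', hn⟩ := h'
      have hbet : I.BetterB (a', b) (a, b) :=
        ⟨rfl, (I.prefB_total b a a' hp (hME ha')).resolve_left hn, hn⟩
      have : 1 ≤ I.aboveB (chi M) (a, b) :=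
        one_le_sum_of_chi (Finset.mem_filter.2 ⟨hME ha', hbet⟩) ha'
      linarith
    · push Not at h
      obtain ⟨b', hb', hn⟩ := h
      have hbet : I.BetterA (a, b') (a, b) :=
        ⟨rfl, (I.prefA_total a b b' hp (hME hb')).resolve_left hn, hn⟩
      have : 1 ≤ I.aboveA (chi M) (a, b) :=
        one_le_sum_of_chi (Finset.mem_filter.2 ⟨hME hb', hbet⟩) hb'
      linarith

theorem Feasible.le_one (hx : I.Feasible x) (p : A × B) : x p ≤ 1 := by
  by_cases hp : p ∈ I.E
  · exact (Finset.single_le_sum (s := I.E.filter fun q => q.1 = p.1) (f := x)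
      (fun q _ => hx.2.2.2.2 q) (Finset.mem_filter.2 ⟨hp, rfl⟩)).trans (hx.2.1 p.1)
  · exact (hx.1 p hp).trans_le zero_le_one

theorem SuperStable.chi_mem_extremePoints (hM : I.SuperStable M) :
    chi M ∈ Set.extremePoints ℝ {y | I.Feasible y} := by
  refine ⟨hM.feasible_chi, ?_⟩
  rintro y hy z hz ⟨s, t, hs, ht, hst, h⟩
  funext p
  have hp := congrFun h p
  simp only [Pi.add_apply, Pi.smul_apply, smul_eq_mul] at hp
  have hy0 := hy.2.2.2.2 p
  have hz0 := hz.2.2.2.2 p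
  have hy1 := Feasible.le_one hy p
  have hz1 := Feasible.le_one hz p
  by_cases hpM : p ∈ M
  · rw [chi_of_mem hpM] at hp ⊢
    nlinarith
  · rw [chi_of_notMem hpM] at hp ⊢
    nlinarith [mul_nonneg ht.le hz0]

theorem sum_sub_mul_div {α : Type*} (T : Finset α) (x c : α → ℝ) (l : ℝ) :
    ∑ p ∈ T, (x p - l * c p) / (1 - l) = (∑ p ∈ T, x p - l * ∑ p ∈ T, c p) / (1 - l) := by
  rw [← Finset.sum_div, Finset.sum_sub_distrib, Finset.mul_sum]

/-- Moving a feasible point away from the incidence vector of its man-optimal matching keeps it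
feasible, as long as the step is small. -/
theorem Feasible.sub_topEdges (hx : I.Feasible x) {l : ℝ} (hl0 : 0 < l) (hl1 : l < 1)
    (hl : ∀ p ∈ I.topEdges x, l ≤ x p) :
    I.Feasible fun p => (x p - l * chi (I.topEdges x) p) / (1 - l) := by
  have h0 := hx.2.2.2.2
  have hM := hx.superStable_topEdges
  have hchi := hM.feasible_chi
  have hpos : 0 < 1 - l := sub_pos.2 hl1
  refine ⟨fun p hp => ?_, fun a => ?_, fun b => ?_, fun p hp => stabIneq_iff.2 ?_, fun p => ?_⟩
  · simp [hx.1 p hp, hchi.1 p hp]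
  · unfold rowSum
    rw [sum_sub_mul_div, div_le_one hpos]
    by_cases hex : ∃ p ∈ I.E, 0 < x p ∧ p.1 = a
    · obtain ⟨p, hp, hppos, rfl⟩ := hex
      obtain ⟨q, hq, hqp⟩ := hx.exists_topEdges_row hp hppos
      have h1 := one_le_sum_of_chi (T := I.E.filter fun q => q.1 = p.1)
        (Finset.mem_filter.2 ⟨(mem_topEdges.1 hq).1, hqp⟩) hq
      have h2 := hx.2.1 p.1
      unfold rowSum at h2
      nlinarith
    · have h1 : ∑ p ∈ I.E.filter (fun p => p.1 = a), x p = 0 :=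
        Finset.sum_eq_zero fun s hs => le_antisymm (not_lt.1 fun hspos => hex
          ⟨s, (Finset.mem_filter.1 hs).1, hspos, (Finset.mem_filter.1 hs).2⟩) (h0 s)
      have h2 : 0 ≤ ∑ p ∈ I.E.filter (fun p => p.1 = a), chi (I.topEdges x) p :=
        Finset.sum_nonneg fun q _ => chi_nonneg _ q
      nlinarith
  · unfold colSum
    rw [sum_sub_mul_div, div_le_one hpos]
    by_cases hex : ∃ p ∈ I.E, 0 < x p ∧ p.2 = b
    · obtain ⟨p, hp, hppos, rfl⟩ := hex
      obtain ⟨q, hq, hqp⟩ := hx.exists_topEdges_col hp hppos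
      have h1 := one_le_sum_of_chi (T := I.E.filter fun q => q.2 = p.2)
        (Finset.mem_filter.2 ⟨(mem_topEdges.1 hq).1, hqp⟩) hq
      have h2 := hx.2.2.1 p.2
      unfold colSum at h2
      nlinarith
    · have h1 : ∑ p ∈ I.E.filter (fun p => p.2 = b), x p = 0 :=
        Finset.sum_eq_zero fun s hs => le_antisymm (not_lt.1 fun hspos => hex
          ⟨s, (Finset.mem_filter.1 hs).1, hspos, (Finset.mem_filter.1 hs).2⟩) (h0 s)
      have h2 : 0 ≤ ∑ p ∈ I.E.filter (fun p => p.2 = b), chi (I.topEdges x) p :=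
        Finset.sum_nonneg fun q _ => chi_nonneg _ q
      nlinarith
  · have hval := stabIneq_iff.1 (hx.2.2.2.1 p hp)
    suffices h : l * (I.aboveA (chi (I.topEdges x)) p + I.aboveB (chi (I.topEdges x)) p +
        chi (I.topEdges x) p - 1) ≤ I.aboveA x p + I.aboveB x p + x p - 1 by
      unfold aboveA aboveB at h ⊢
      rw [sum_sub_mul_div, sum_sub_mul_div, ← add_div, ← add_div, le_div_iff₀ hpos]
      linarith
    have hA1 := (aboveA_le_rowSum (I := I) (chi_nonneg (I.topEdges x)) p).trans (hchi.2.1 p.1)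
    have hB1 := (aboveB_le_colSum (I := I) (chi_nonneg (I.topEdges x)) p).trans (hchi.2.2.1 p.2)
    by_cases hAM : ∃ q ∈ I.topEdges x, I.BetterA q p
    · by_cases hBM : ∃ q ∈ I.topEdges x, I.BetterB q p
      · obtain ⟨q, hq, hqp⟩ := hAM
        obtain ⟨s, hs, hsp⟩ := hBM
        have hpM : p ∉ I.topEdges x := fun hpM =>
          hqp.asymm (hM.1.2.1 q hq p hpM hqp.1 ▸ hqp)
        rw [chi_of_notMem hpM]
        have h1 := aboveA_add_le h0 (mem_topEdges.1 hq).1 hqp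
        have h2 := aboveB_add_le h0 (mem_topEdges.1 hs).1 hsp
        have h3 := hx.aboveB_add_eq_one hs
        have h4 := hl q hq
        have h5 := aboveA_nonneg (I := I) h0 q
        have h6 := h0 p
        nlinarith
      · have hB0 : I.aboveB (chi (I.topEdges x)) p = 0 := Finset.sum_eq_zero fun s hs =>
          chi_of_notMem fun hsM => hBM ⟨s, hsM, (Finset.mem_filter.1 hs).2⟩
        obtain ⟨q, hq, hqp⟩ := hAM
        have hpM : p ∉ I.topEdges x := fun hpM =>
          hqp.asymm (hM.1.2.1 q hq p hpM hqp.1 ▸ hqp)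
        rw [chi_of_notMem hpM]
        nlinarith
    · have hA0 : I.aboveA (chi (I.topEdges x)) p = 0 := Finset.sum_eq_zero fun s hs =>
        chi_of_notMem fun hsM => hAM ⟨s, hsM, (Finset.mem_filter.1 hs).2⟩
      have hB2 : I.aboveB (chi (I.topEdges x)) p + chi (I.topEdges x) p ≤ 1 := by
        by_cases hpM : p ∈ I.topEdges x
        · have hB0 : I.aboveB (chi (I.topEdges x)) p = 0 := Finset.sum_eq_zero fun s hs =>
            chi_of_notMem fun hsM => by
              have hsp := (Finset.mem_filter.1 hs).2
              exact hsp.asymm (hM.1.2.2 s hsM p hpM hsp.1 ▸ hsp)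
          rw [hB0, chi_of_mem hpM, zero_add]
        · rwa [chi_of_notMem hpM, add_zero]
      nlinarith
  · refine div_nonneg ?_ hpos.le
    by_cases hpM : p ∈ I.topEdges x
    · rw [chi_of_mem hpM]
      linarith [hl p hpM]
    · rw [chi_of_notMem hpM]
      linarith [h0 p]

theorem eq_chi_of_mem_extremePoints (hx : x ∈ Set.extremePoints ℝ {y | I.Feasible y}) :
    x = chi (I.topEdges x) := by
  obtain ⟨hfeas : I.Feasible x, hext⟩ := hx
  obtain ⟨l, hl0, hl1, hl⟩ : ∃ l : ℝ, 0 < l ∧ l < 1 ∧ ∀ p ∈ I.topEdges x, l ≤ x p := by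
    rcases (I.topEdges x).eq_empty_or_nonempty with h | h
    · exact ⟨1 / 2, by norm_num, by norm_num, by simp [h]⟩
    · obtain ⟨q, hq, hmin⟩ := Finset.exists_min_image _ x h
      exact ⟨min (1 / 2) (x q), lt_min (by norm_num) (mem_topEdges.1 hq).2.1,
        (min_le_left _ _).trans_lt (by norm_num), fun p hp => (min_le_right _ _).trans (hmin p hp)⟩
  refine (hext hfeas.superStable_topEdges.feasible_chi (hfeas.sub_topEdges hl0 hl1 hl)
    ⟨l, 1 - l, hl0, sub_pos.2 hl1, by ring, ?_⟩).symm
  funext p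
  have : 1 - l ≠ 0 := (sub_pos.2 hl1).ne'
  simp only [Pi.add_apply, Pi.smul_apply, smul_eq_mul]
  field_simp
  ring

theorem mem_extremePoints_feasible_iff :
    x ∈ Set.extremePoints ℝ {y | I.Feasible y} ↔ ∃ M, I.SuperStable M ∧ x = chi M := by
  constructor
  · exact fun hx => ⟨_, Feasible.superStable_topEdges hx.1, eq_chi_of_mem_extremePoints hx⟩
  · rintro ⟨M, hM, rfl⟩
    exact hM.chi_mem_extremePoints

theorem isClosed_feasible (I : SMInstance A B) : IsClosed {y | I.Feasible y} := by
  have hsum (T : Finset (A × B)) : Continuous fun y : A × B → ℝ => ∑ p ∈ T, y p :=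
    continuous_finsetSum _ fun p _ => continuous_apply p
  simp only [Feasible, stabIneq_iff, Set.ofPred_and, Set.ofPred_forall]
  refine .inter ?_ (.inter ?_ (.inter ?_ (.inter ?_ ?_)))
  · exact isClosed_iInter fun p => isClosed_iInter fun _ =>
      isClosed_eq (continuous_apply p) continuous_const
  · exact isClosed_iInter fun a => isClosed_le (hsum _) continuous_const
  · exact isClosed_iInter fun b => isClosed_le (hsum _) continuous_const
  · exact isClosed_iInter fun p => isClosed_iInter fun _ =>
      isClosed_le continuous_const (((hsum _).add (hsum _)).add (continuous_apply p))
  · exact isClosed_iInter fun p => isClosed_le continuous_const (continuous_apply p)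

theorem isCompact_feasible (I : SMInstance A B) : IsCompact {y | I.Feasible y} :=
  (isCompact_univ_pi fun _ : A × B => isCompact_Icc (a := (0 : ℝ)) (b := 1)).of_isClosed_subset
    I.isClosed_feasible fun _ hy p _ => ⟨hy.2.2.2.2 p, Feasible.le_one hy p⟩

theorem convex_feasible (I : SMInstance A B) : Convex ℝ {y | I.Feasible y} := by
  intro y hy z hz s t hs ht hst
  have hsum (T : Finset (A × B)) : ∑ p ∈ T, (s • y + t • z) p =
      s * ∑ p ∈ T, y p + t * ∑ p ∈ T, z p := by
    simp [Finset.sum_add_distrib, Finset.mul_sum]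
  obtain ⟨y1, y2, y3, y4, y5⟩ := hy
  obtain ⟨z1, z2, z3, z4, z5⟩ := hz
  refine ⟨fun p hp => by simp [y1 p hp, z1 p hp], fun a => ?_, fun b => ?_,
    fun p hp => stabIneq_iff.2 ?_, fun p => ?_⟩
  · have hy := y2 a
    have hz := z2 a
    unfold rowSum at hy hz ⊢
    rw [hsum]
    nlinarith
  · have hy := y3 b
    have hz := z3 b
    unfold colSum at hy hz ⊢
    rw [hsum]
    nlinarith
  · have hy := stabIneq_iff.1 (y4 p hp)
    have hz := stabIneq_iff.1 (z4 p hp)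
    unfold aboveA aboveB at hy hz ⊢
    rw [hsum, hsum]
    simp only [Pi.add_apply, Pi.smul_apply, smul_eq_mul]
    nlinarith
  · exact add_nonneg (mul_nonneg hs (y5 p)) (mul_nonneg ht (z5 p))

theorem finite_setOf_chi (I : SMInstance A B) :
    {y : A × B → ℝ | ∃ M, I.SuperStable M ∧ y = chi M}.Finite :=
  (I.E.powerset.finite_toSet.image chi).subset fun _ ⟨M, hM, hy⟩ =>
    ⟨M, Finset.mem_coe.2 (Finset.mem_powerset.2 hM.1.1), hy.symm⟩

end SMInstance

/-- The super-stable matching polytope is integral: a vector `x ∈ ℝ^E` is an extreme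
point of the polytope defined by the linear system (a)–(c) iff `x = χ^M` for some
super-stable matching `M`; consequently this polytope is the convex hull of the
incidence vectors of the super-stable matchings of `G`. -/
theorem super_stable_polytope_integral {A B : Type*} (I : SMInstance A B) :
    (∀ x : A × B → ℝ,
      x ∈ Set.extremePoints ℝ {y | I.Feasible y} ↔
        ∃ M, I.SuperStable M ∧ x = SMInstance.chi M) ∧
    {y | I.Feasible y} =
      convexHull ℝ {y | ∃ M, I.SuperStable M ∧ y = SMInstance.chi M} := by
  refine ⟨fun x => SMInstance.mem_extremePoints_feasible_iff, ?_⟩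
  have hext : Set.extremePoints ℝ {y | I.Feasible y} =
      {y | ∃ M, I.SuperStable M ∧ y = SMInstance.chi M} :=
    Set.ext fun x => SMInstance.mem_extremePoints_feasible_iff
  rw [← closure_convexHull_extremePoints I.isCompact_feasible I.convex_feasible, hext]
  exact (I.finite_setOf_chi.isClosed_convexHull ℝ).closure_eq
end

section
/- Let x ∈ ℝ^E be a feasible solution of the super-stable matching linear system (a)–(c). For each vertex u and each vertex v that is a maximal element (with respect to ⪰_u) of the support {i ∈ N(u) : x_{u,i} > 0}, the following hold: ∑_{j ∈ N(v)} x_{j,v} = 1; x_{j,v} = 0 for every j with u ≻_v j; and x_{j,v} = 0 for every j ≠ u with j =_v u. In particular, u is the unique minimal element (with respect to ⪰_v) of {j ∈ N(v) : x_{j,v} > 0}. -/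
open scoped Classical

/-- If a nonnegative function has sum at most `1` over `S`, and its sum over the elements of
`S` satisfying `Q` together with one further element `p` is at least `1`, then the sum over `S`
is `1` and the function vanishes on every other element of `S` not satisfying `Q`. -/
theorem Finset.sum_eq_one_and_eq_zero_of_one_le_sum_filter_add {α : Type*} {S : Finset α}
    {x : α → ℝ} {Q : α → Prop} {p : α} (hx : ∀ q, 0 ≤ x q) (hp : p ∈ S) (hQ : ¬ Q p)
    (hle : ∑ q ∈ S, x q ≤ 1) (hge : 1 ≤ ∑ q ∈ S.filter Q, x q + x p) :
    ∑ q ∈ S, x q = 1 ∧ ∀ q ∈ S, q ≠ p → ¬ Q q → x q = 0 := by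
  have hsplit := Finset.sum_filter_add_sum_filter_not S Q x
  have hp' : p ∈ S.filter (fun q => ¬ Q q) := Finset.mem_filter.2 ⟨hp, hQ⟩
  have herase := Finset.add_sum_erase _ x hp'
  have hnonneg : 0 ≤ ∑ q ∈ (S.filter (fun q => ¬ Q q)).erase p, x q :=
    Finset.sum_nonneg fun q _ => hx q
  refine ⟨by linarith, fun q hq hne hnQ => ?_⟩
  have hzero : ∑ q ∈ (S.filter (fun q => ¬ Q q)).erase p, x q = 0 := by linarith
  exact (Finset.sum_eq_zero_iff_of_nonneg fun q _ => hx q).1 hzero q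
    (Finset.mem_erase.2 ⟨hne, Finset.mem_filter.2 ⟨hq, hnQ⟩⟩)

/-- For a feasible solution `x` of the super-stable matching linear system and any
vertex `u` (of either color class), if `v` is a maximal element (w.r.t. `⪰_u`) of the
support `{i ∈ N(u) : x_{u,i} > 0}`, then `∑_{j ∈ N(v)} x_{j,v} = 1`, `x_{j,v} = 0`
for every `j` with `u ≻_v j`, `x_{j,v} = 0` for every `j ≠ u` with `j =_v u`, and in
particular `u` is the unique minimal element (w.r.t. `⪰_v`) of
`{j ∈ N(v) : x_{j,v} > 0}`. -/
theorem feasible_maximal_support {A B : Type*} (I : SMInstance A B)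
    (x : A × B → ℝ) (hx : I.Feasible x) :
    (∀ (u : A) (v : B), (u, v) ∈ I.E → 0 < x (u, v) →
      (∀ i, (u, i) ∈ I.E → 0 < x (u, i) → ¬ I.SPrefA u i v) →
      I.colSum x v = 1 ∧
      (∀ j, (j, v) ∈ I.E → I.SPrefB v u j → x (j, v) = 0) ∧
      (∀ j, (j, v) ∈ I.E → j ≠ u → I.prefB v j u ∧ I.prefB v u j → x (j, v) = 0) ∧
      (0 < x (u, v) ∧ ∀ j, (j, v) ∈ I.E → 0 < x (j, v) → j ≠ u → I.SPrefB v j u)) ∧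
    (∀ (u : B) (v : A), (v, u) ∈ I.E → 0 < x (v, u) →
      (∀ i, (i, u) ∈ I.E → 0 < x (i, u) → ¬ I.SPrefB u i v) →
      I.rowSum x v = 1 ∧
      (∀ j, (v, j) ∈ I.E → I.SPrefA v u j → x (v, j) = 0) ∧
      (∀ j, (v, j) ∈ I.E → j ≠ u → I.prefA v j u ∧ I.prefA v u j → x (v, j) = 0) ∧
      (0 < x (v, u) ∧ ∀ j, (v, j) ∈ I.E → 0 < x (v, j) → j ≠ u → I.SPrefA v j u)) := by
  obtain ⟨-, hrow, hcol, hstab, hnn⟩ := hx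
  constructor
  · intro u v he hpos hmax
    have hz : ∑ q ∈ I.E.filter (fun q => q.1 = u ∧ I.SPrefA u q.2 v), x q = 0 := by
      refine Finset.sum_eq_zero fun q hq => ?_
      obtain ⟨a, b⟩ := q
      obtain ⟨hqE, rfl, hpref⟩ := Finset.mem_filter.1 hq
      by_contra hne
      exact hmax _ hqE (lt_of_le_of_ne (hnn _) (Ne.symm hne)) hpref
    have hst := hstab _ he
    unfold SMInstance.StabIneq at hst
    obtain ⟨hsum, hzero⟩ := Finset.sum_eq_one_and_eq_zero_of_one_le_sum_filter_add
      (α := A × B) (S := I.E.filter (fun q => q.2 = v)) (Q := fun q => I.SPrefB v q.1 u) (p := (u, v))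
      hnn (Finset.mem_filter.2 ⟨he, rfl⟩) (fun h => h.2 h.1) (hcol v)
      (by rw [Finset.filter_filter]; linarith)
    have hvanish : ∀ j, (j, v) ∈ I.E → j ≠ u → ¬ I.SPrefB v j u → x (j, v) = 0 :=
      fun j hj hne hnp => hzero _ (Finset.mem_filter.2 ⟨hj, rfl⟩)
        (fun h => hne (congrArg Prod.fst h)) hnp
    refine ⟨hsum, fun j hj hp => hvanish j hj ?_ fun h => hp.2 h.1,
      fun j hj hne hp => hvanish j hj hne fun h => h.2 hp.2, hpos, fun j hj hj0 hne => ?_⟩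
    · rintro rfl
      exact hp.2 hp.1
    · by_contra hnp
      exact hj0.ne' (hvanish j hj hne hnp)
  · intro u v he hpos hmax
    have hz : ∑ q ∈ I.E.filter (fun q => q.2 = u ∧ I.SPrefB u q.1 v), x q = 0 := by
      refine Finset.sum_eq_zero fun q hq => ?_
      obtain ⟨a, b⟩ := q
      obtain ⟨hqE, rfl, hpref⟩ := Finset.mem_filter.1 hq
      by_contra hne
      exact hmax _ hqE (lt_of_le_of_ne (hnn _) (Ne.symm hne)) hpref
    have hst := hstab _ he
    unfold SMInstance.StabIneq at hst
    obtain ⟨hsum, hzero⟩ := Finset.sum_eq_one_and_eq_zero_of_one_le_sum_filter_add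
      (α := A × B) (S := I.E.filter (fun q => q.1 = v)) (Q := fun q => I.SPrefA v q.2 u) (p := (v, u))
      hnn (Finset.mem_filter.2 ⟨he, rfl⟩) (fun h => h.2 h.1) (hrow v)
      (by rw [Finset.filter_filter]; linarith)
    have hvanish : ∀ j, (v, j) ∈ I.E → j ≠ u → ¬ I.SPrefA v j u → x (v, j) = 0 :=
      fun j hj hne hnp => hzero _ (Finset.mem_filter.2 ⟨hj, rfl⟩)
        (fun h => hne (congrArg Prod.snd h)) hnp
    refine ⟨hsum, fun j hj hp => hvanish j hj ?_ fun h => hp.2 h.1,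
      fun j hj hne hp => hvanish j hj hne fun h => h.2 hp.2, hpos, fun j hj hj0 hne => ?_⟩
    · rintro rfl
      exact hp.2 hp.1
    · by_contra hnp
      exact hj0.ne' (hvanish j hj hne hnp)
end

section
/- (Self-duality of the super-stable matching polytope.) Let x ∈ ℝ^E be a feasible solution of the super-stable matching linear system (a)–(c), and define α_v = ∑_{i ∈ N(v)} x_{v,i} for every v ∈ V. Then (α, x) is a feasible solution of the dual linear program, i.e., α_u + α_v − ∑_{i : v ≻_u i} x_{u,i} − ∑_{j : u ≻_v j} x_{v,j} − x_{u,v} ≥ 1 for every (u,v) ∈ E, α_v ≥ 0 for all v, and x ≥ 0; moreover the dual objective equals the primal objective: ∑_{v ∈ V} α_v − ∑_{(u,v) ∈ E} x_{u,v} = ∑_{(u,v) ∈ E} x_{u,v}. Consequently, x is an optimal solution of the primal LP maximizing ∑_{(u,v) ∈ E} x_{u,v} over the feasible region. -/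
open scoped Classical

/-- Exchange of summation over a relation on a finite set. -/
theorem sum_mul_sum_filter_comm {ι : Type*} (s : Finset ι) (R S : ι → ι → Prop)
    [∀ p, DecidablePred (R p)] [∀ q, DecidablePred (S q)] (hRS : ∀ p q, R p q ↔ S q p)
    (x y : ι → ℝ) :
    ∑ p ∈ s, y p * ∑ q ∈ s.filter (R p), x q = ∑ q ∈ s, x q * ∑ p ∈ s.filter (S q), y p := by
  simp only [Finset.sum_filter, Finset.mul_sum]
  rw [Finset.sum_comm]
  refine Finset.sum_congr rfl fun q _ => Finset.sum_congr rfl fun p _ => ?_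
  simp only [hRS p q, mul_ite, mul_zero, mul_comm]

/-- The sums of a nonnegative function over two disjoint parts of a filter and at a point of the
filter outside both are together at most the sum over the filter. -/
theorem sum_filter_add_sum_filter_add_le {ι : Type*} (s : Finset ι) (P Q T : ι → Prop)
    [DecidablePred P] [DecidablePred Q] [DecidablePred T] {x : ι → ℝ} (hx : ∀ i, 0 ≤ x i)
    {p : ι} (hp : p ∈ s) (hPT : ∀ i, P i → T i) (hQT : ∀ i, Q i → T i) (hT : T p)
    (hPQ : ∀ i, P i → ¬ Q i) (hP : ¬ P p) (hQ : ¬ Q p) :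
    ∑ i ∈ s.filter P, x i + ∑ i ∈ s.filter Q, x i + x p ≤ ∑ i ∈ s.filter T, x i := by
  have hxp : x p = ∑ i ∈ s, if i = p then x i else 0 := by simp [hp]
  rw [hxp, Finset.sum_filter, Finset.sum_filter, Finset.sum_filter, ← Finset.sum_add_distrib,
    ← Finset.sum_add_distrib]
  refine Finset.sum_le_sum fun i _ => ?_
  have h0 := hx i
  by_cases hip : i = p
  · subst hip
    simp [hP, hQ, hT]
  · have h1 := hPT i
    have h2 := hQT i
    have h3 := hPQ i
    by_cases hPi : P i <;> by_cases hQi : Q i <;> by_cases hTi : T i <;> simp_all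

namespace SMInstance

variable {A B : Type*}

theorem Feasible.dual_constraint {I : SMInstance A B} {x : A × B → ℝ} (hx : I.Feasible x)
    {p : A × B} (hp : p ∈ I.E) :
    I.rowSum x p.1 + I.colSum x p.2
      - (∑ q ∈ I.E.filter (fun q => q.1 = p.1 ∧ I.SPrefA p.1 p.2 q.2), x q)
      - (∑ q ∈ I.E.filter (fun q => q.2 = p.2 ∧ I.SPrefB p.2 p.1 q.1), x q)
      - x p ≥ 1 := by
  obtain ⟨-, -, -, hstab, h0⟩ := hx
  have hs := hstab p hp
  have hrow := sum_filter_add_sum_filter_add_le I.E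
    (fun q => q.1 = p.1 ∧ I.SPrefA p.1 q.2 p.2) (fun q => q.1 = p.1 ∧ I.SPrefA p.1 p.2 q.2)
    (fun q => q.1 = p.1) h0 hp (fun _ h => h.1) (fun _ h => h.1) rfl
    (fun _ h h' => h.2.2 h'.2.1) (fun h => h.2.2 h.2.1) (fun h => h.2.2 h.2.1)
  have hcol := sum_filter_add_sum_filter_add_le I.E
    (fun q => q.2 = p.2 ∧ I.SPrefB p.2 q.1 p.1) (fun q => q.2 = p.2 ∧ I.SPrefB p.2 p.1 q.1)
    (fun q => q.2 = p.2) h0 hp (fun _ h => h.1) (fun _ h => h.1) rfl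
    (fun _ h h' => h.2.2 h'.2.1) (fun h => h.2.2 h.2.1) (fun h => h.2.2 h.2.1)
  unfold StabIneq at hs
  unfold rowSum colSum
  linarith

theorem Feasible.sum_le_sum {I : SMInstance A B} {x y : A × B → ℝ} (hx : I.Feasible x)
    (hy : I.Feasible y) : ∑ p ∈ I.E, y p ≤ ∑ p ∈ I.E, x p := by
  have hdual := Finset.sum_le_sum fun p hp =>
    mul_le_mul_of_nonneg_left (hx.dual_constraint hp) (hy.2.2.2.2 p)
  obtain ⟨-, -, -, -, hx0⟩ := hx
  obtain ⟨-, hrow, hcol, hstab, -⟩ := hy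
  have hprimal : ∑ q ∈ I.E, x q * (I.rowSum y q.1 + I.colSum y q.2
      - (∑ p ∈ I.E.filter (fun p => p.1 = q.1 ∧ I.SPrefA q.1 p.2 q.2), y p)
      - (∑ p ∈ I.E.filter (fun p => p.2 = q.2 ∧ I.SPrefB q.2 p.1 q.1), y p)
      - y q) ≤ ∑ q ∈ I.E, x q * 1 := by
    refine Finset.sum_le_sum fun q hq => mul_le_mul_of_nonneg_left ?_ (hx0 q)
    have h1 := hrow q.1
    have h2 := hcol q.2
    have h3 := hstab q hq
    unfold StabIneq at h3
    linarith
  simp only [mul_add, mul_sub, mul_one, Finset.sum_add_distrib, Finset.sum_sub_distrib,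
    rowSum, colSum] at hdual hprimal
  have e1 := sum_mul_sum_filter_comm I.E (fun p q => q.1 = p.1) (fun q p => p.1 = q.1)
    (fun _ _ => eq_comm) x y
  have e2 := sum_mul_sum_filter_comm I.E (fun p q => q.2 = p.2) (fun q p => p.2 = q.2)
    (fun _ _ => eq_comm) x y
  have e3 := sum_mul_sum_filter_comm I.E (fun p q => q.1 = p.1 ∧ I.SPrefA p.1 p.2 q.2)
    (fun q p => p.1 = q.1 ∧ I.SPrefA q.1 p.2 q.2) (by grind) x y
  have e4 := sum_mul_sum_filter_comm I.E (fun p q => q.2 = p.2 ∧ I.SPrefB p.2 p.1 q.1)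
    (fun q p => p.2 = q.2 ∧ I.SPrefB q.2 p.1 q.1) (by grind) x y
  have e5 : ∑ p ∈ I.E, y p * x p = ∑ p ∈ I.E, x p * y p := by simp only [mul_comm]
  linarith

theorem sum_rowSum [Fintype A] (I : SMInstance A B) (x : A × B → ℝ) :
    ∑ a : A, I.rowSum x a = ∑ p ∈ I.E, x p :=
  Finset.sum_fiberwise I.E Prod.fst x

theorem sum_colSum [Fintype B] (I : SMInstance A B) (x : A × B → ℝ) :
    ∑ b : B, I.colSum x b = ∑ p ∈ I.E, x p :=
  Finset.sum_fiberwise I.E Prod.snd x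

end SMInstance

/-- Self-duality: for a feasible solution `x` of the super-stable matching linear
system, setting `α_v := ∑_{i ∈ N(v)} x_{v,i}` for every vertex `v`, the pair `(α, x)`
is feasible for the dual LP, the dual objective `∑_v α_v − ∑_{(u,v) ∈ E} x_{u,v}`
equals the primal objective `∑_{(u,v) ∈ E} x_{u,v}`, and consequently `x` is an
optimal solution of the primal LP maximizing `∑_{(u,v) ∈ E} x_{u,v}`. -/
theorem self_duality {A B : Type*} [Fintype A] [Fintype B] (I : SMInstance A B)
    (x : A × B → ℝ) (hx : I.Feasible x) :
    (∀ p ∈ I.E,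
      I.rowSum x p.1 + I.colSum x p.2
        - (∑ q ∈ I.E.filter (fun q => q.1 = p.1 ∧ I.SPrefA p.1 p.2 q.2), x q)
        - (∑ q ∈ I.E.filter (fun q => q.2 = p.2 ∧ I.SPrefB p.2 p.1 q.1), x q)
        - x p ≥ 1) ∧
    (∀ a : A, 0 ≤ I.rowSum x a) ∧
    (∀ b : B, 0 ≤ I.colSum x b) ∧
    (∀ p, 0 ≤ x p) ∧
    ((∑ a : A, I.rowSum x a) + (∑ b : B, I.colSum x b) - (∑ p ∈ I.E, x p)
      = ∑ p ∈ I.E, x p) ∧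
    (∀ y : A × B → ℝ, I.Feasible y → (∑ p ∈ I.E, y p) ≤ ∑ p ∈ I.E, x p) := by
  refine ⟨fun p hp => hx.dual_constraint hp, fun a => Finset.sum_nonneg fun p _ => hx.2.2.2.2 p,
    fun b => Finset.sum_nonneg fun p _ => hx.2.2.2.2 p, hx.2.2.2.2, ?_,
    fun y hy => hx.sum_le_sum hy⟩
  rw [I.sum_rowSum, I.sum_colSum, add_sub_cancel_right]
end
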